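/- For all integers k₁, k₂ ≥ 1, set k := max(k₁, k₂). Every strongly 8·10⁸·k²·(k+1)²-connected tournament T with two distinct vertices v₁, v₂ ∈ V(T) admits a partition of V(T) into two sets V₁ and V₂ such that v₁ ∈ V₁, v₂ ∈ V₂, the subtournament T[V₁] is strongly k₁-connected, and the subtournament T[V₂] is strongly k₂-connected. -/

import Mathlib

/-- A digraph on the vertex type `V`, given by its adjacency (directed edge) relation. -/
structure Digr (V : Type) where
  Adj : V → V → Prop

namespace Digr

variable {V : Type}

/-- No loops. -/
def Loopless (G : Digr V) : Prop := ∀ v, ¬ G.Adj v v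

/-- A tournament: every pair of distinct vertices is joined by exactly one directed edge. -/
def IsTournament (G : Digr V) : Prop :=
  G.Loopless ∧ ∀ u v : V, u ≠ v → (G.Adj u v ↔ ¬ G.Adj v u)

/-- A semicomplete digraph: every pair of distinct vertices is joined by at least one
directed edge (edges in both directions are allowed). -/
def IsSemicomplete (G : Digr V) : Prop :=
  G.Loopless ∧ ∀ u v : V, u ≠ v → (G.Adj u v ∨ G.Adj v u)

/-- Out-neighbourhood `N⁺_G(v)`. -/
def outN (G : Digr V) (v : V) : Set V := {u | G.Adj v u}

/-- In-neighbourhood `N⁻_G(v)`. -/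
def inN (G : Digr V) (v : V) : Set V := {u | G.Adj u v}

/-- Union of two digraphs (on the same vertex type). -/
def union (G H : Digr V) : Digr V := ⟨fun a b => G.Adj a b ∨ H.Adj a b⟩

/-- `l` is a directed path of `G` lying inside the vertex set `A`, from `u` to `v`. -/
def IsPathOn (G : Digr V) (A : Set V) (u v : V) (l : List V) : Prop :=
  l.Nodup ∧ l.Chain' G.Adj ∧ (∀ x ∈ l, x ∈ A) ∧ l.head? = some u ∧ l.getLast? = some v

/-- There is a directed path of `G` inside `A` from `u` to `v`. -/
def Reaches (G : Digr V) (A : Set V) (u v : V) : Prop :=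
  ∃ l, G.IsPathOn A u v l

/-- The induced subdigraph of `G` on `W` is strongly `k`-connected: `|W| ≥ k + 1` and for
every ordered pair of distinct vertices of `W` and every `S ⊆ W ∖ {u,v}` with `|S| ≤ k - 1`
there is a directed path from `u` to `v` avoiding `S`. -/
def StronglyConnOn (G : Digr V) (W : Set V) (k : ℕ) : Prop :=
  k + 1 ≤ W.ncard ∧
  ∀ u ∈ W, ∀ v ∈ W, u ≠ v → ∀ S : Set V, S ⊆ W \ {u, v} → S.ncard < k →
    G.Reaches (W \ S) u v

/-- Strong `c`-connectedness for a real parameter `c` (the condition on the removed set `S`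
is `|S| ≤ c - 1`). -/
def StronglyConnOnR (G : Digr V) (W : Set V) (c : ℝ) : Prop :=
  c + 1 ≤ (W.ncard : ℝ) ∧
  ∀ u ∈ W, ∀ v ∈ W, u ≠ v → ∀ S : Set V, S ⊆ W \ {u, v} → (S.ncard : ℝ) ≤ c - 1 →
    G.Reaches (W \ S) u v

/-- `l` is a directed cycle of `G` (length at least 3) whose vertex set is `C`. -/
def IsCycleOn (G : Digr V) (C : Set V) (l : List V) : Prop :=
  3 ≤ l.length ∧ l.Nodup ∧ (∀ x, x ∈ l ↔ x ∈ C) ∧ l.Chain' G.Adj ∧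
  ∃ a b, l.getLast? = some a ∧ l.head? = some b ∧ G.Adj a b

/-- The pair `(v, U)` is `k`-connected in the induced subdigraph of `G` on `A`: after
deleting any `S ⊆ A ∖ {v}` with `|S| ≤ k - 1` there is a path from `v` to some vertex
of `U ∖ S` inside `A ∖ S`. -/
def VtxSetConn (G : Digr V) (A : Set V) (v : V) (U : Set V) (k : ℕ) : Prop :=
  ∀ S : Set V, S ⊆ A \ {v} → S.ncard < k → ∃ u ∈ U \ S, G.Reaches (A \ S) v u

/-- The pair `(U, v)` is `k`-connected in the induced subdigraph of `G` on `A`. -/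
def SetVtxConn (G : Digr V) (A : Set V) (U : Set V) (v : V) (k : ℕ) : Prop :=
  ∀ S : Set V, S ⊆ A \ {v} → S.ncard < k → ∃ u ∈ U \ S, G.Reaches (A \ S) u v

end Digr

open Digr

namespace Digr

variable {V : Type}

/-- The digraph with all edges reversed. -/
def rev (G : Digr V) : Digr V := ⟨fun a b => G.Adj b a⟩

theorem IsTournament.rev {G : Digr V} (hG : G.IsTournament) : G.rev.IsTournament :=
  ⟨hG.1, fun u v h => hG.2 v u h.symm⟩

theorem IsTournament.asymm {G : Digr V} (hG : G.IsTournament) {u v : V} (h : G.Adj u v) :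
    ¬ G.Adj v u := by
  have hne : u ≠ v := by rintro rfl; exact hG.1 _ h
  exact (hG.2 u v hne).1 h

theorem IsTournament.adj_of_not {G : Digr V} (hG : G.IsTournament) {u v : V} (hne : u ≠ v)
    (h : ¬ G.Adj v u) : G.Adj u v := (hG.2 u v hne).2 h

theorem IsPathOn.rev {G : Digr V} {A : Set V} {u v : V} {l : List V} (h : G.IsPathOn A u v l) :
    G.rev.IsPathOn A v u l.reverse := by
  obtain ⟨h1, h2, h3, h4, h5⟩ := h
  refine ⟨List.nodup_reverse.2 h1, List.isChain_reverse.2 h2, fun x hx => h3 x (by simpa using hx),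
    by simpa using h5, by simpa using h4⟩

theorem Reaches.rev {G : Digr V} {A : Set V} {u v : V} (h : G.Reaches A u v) :
    G.rev.Reaches A v u := by
  obtain ⟨l, hl⟩ := h
  exact ⟨_, hl.rev⟩

theorem reaches_iff {G : Digr V} {A : Set V} {u v : V} :
    G.Reaches A u v ↔ u ∈ A ∧ Relation.ReflTransGen (fun x y => G.Adj x y ∧ y ∈ A) u v := by
  constructor
  · rintro ⟨l, -, h2, h3, h4, h5⟩
    induction l generalizing u with
    | nil => simp at h4
    | cons a l ih =>
      obtain rfl : a = u := by simpa using h4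
      refine ⟨h3 a (by simp), ?_⟩
      cases l with
      | nil =>
        obtain rfl : a = v := by simpa using h5
        exact .refl
      | cons b l =>
        have h := List.isChain_cons_cons.1 h2
        have := ih h.2 (fun x hx => h3 x (by simp [hx])) (u := b) (by simp) (by simpa using h5)
        exact .head ⟨h.1, this.1⟩ this.2
  · rintro ⟨hu, h⟩
    induction h using Relation.ReflTransGen.head_induction_on with
    | refl => exact ⟨[v], by simp, List.isChain_singleton v, by simpa using hu, by simp, by simp⟩
    | @head a b hab _ ih =>
      obtain ⟨l, h1, h2, h3, h4, h5⟩ := ih hab.2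
      by_cases hal : a ∈ l
      · obtain ⟨l1, l2, rfl⟩ := List.append_of_mem hal
        refine ⟨a :: l2, (List.nodup_append.1 h1).2.1, (List.isChain_append.1 h2).2.1,
          fun x hx => h3 x (List.mem_append_right _ hx), by simp, by simpa using h5⟩
      · cases l with
        | nil => simp at h4
        | cons c l =>
          obtain rfl : c = b := by simpa using h4
          refine ⟨a :: c :: l, List.nodup_cons.2 ⟨hal, h1⟩, List.isChain_cons_cons.2 ⟨hab.1, h2⟩,
            ?_, by simp, by simpa using h5⟩
          intro x hx
          rcases List.mem_cons.1 hx with rfl | hx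
          · exact hu
          · exact h3 x hx

theorem Reaches.refl {G : Digr V} {A : Set V} {u : V} (h : u ∈ A) : G.Reaches A u u :=
  reaches_iff.2 ⟨h, .refl⟩

theorem Reaches.left_mem {G : Digr V} {A : Set V} {u v : V} (h : G.Reaches A u v) : u ∈ A :=
  (reaches_iff.1 h).1

theorem Reaches.right_mem {G : Digr V} {A : Set V} {u v : V} (h : G.Reaches A u v) : v ∈ A :=
  h.rev.left_mem

theorem Reaches.trans {G : Digr V} {A : Set V} {u v w : V} (h : G.Reaches A u v)
    (h' : G.Reaches A v w) : G.Reaches A u w :=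
  reaches_iff.2 ⟨h.left_mem, (reaches_iff.1 h).2.trans (reaches_iff.1 h').2⟩

theorem Reaches.mono {G : Digr V} {A B : Set V} {u v : V} (hAB : A ⊆ B)
    (h : G.Reaches A u v) : G.Reaches B u v := by
  obtain ⟨l, h1, h2, h3, h4⟩ := h
  exact ⟨l, h1, h2, fun x hx => hAB (h3 x hx), h4⟩

theorem Reaches.of_adj {G : Digr V} {A : Set V} {u v : V} (hu : u ∈ A) (hv : v ∈ A)
    (h : G.Adj u v) : G.Reaches A u v :=
  reaches_iff.2 ⟨hu, .single ⟨h, hv⟩⟩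

/-- Vertices of `U` that are robustly reached from the vertices of `U` outside `E`: either they
lie outside `E`, or they have `k` in-neighbours in `U` that are robustly reached themselves. -/
inductive InGood (G : Digr V) (E U : Finset V) (k : ℕ) : V → Prop
  | base (v : V) (hv : v ∈ U) (hE : v ∉ E) : InGood G E U k v
  | step (v : V) (hv : v ∈ U) (S : Finset V) (hk : k ≤ S.card) (hadj : ∀ u ∈ S, G.Adj u v)
      (hS : ∀ u ∈ S, InGood G E U k u) : InGood G E U k v

theorem InGood.mono {G : Digr V} {E E' U U' : Finset V} {k : ℕ} {v : V} (hE : E' ⊆ E)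
    (hU : U ⊆ U') (h : G.InGood E U k v) : G.InGood E' U' k v := by
  induction h with
  | base v hv h => exact .base v (hU hv) fun h' => h (hE h')
  | step v hv S hk hadj _ ih => exact .step v (hU hv) S hk hadj ih

theorem InGood.reaches [DecidableEq V] {G : Digr V} {E U C : Finset V} {k : ℕ} {y : V}
    (hCU : C ⊆ U) (hC : ∀ v ∈ U, v ∉ E → G.Reaches (insert v C : Finset V) y v)
    {S : Set V} (hfin : S.Finite) (hS : S.ncard < k) (hSC : ∀ x ∈ C, x ∉ S) {v : V}
    (h : G.InGood E U k v) (hvS : v ∉ S) : G.Reaches (↑U \ S) y v := by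
  induction h with
  | base v hv hE =>
    refine (hC v hv hE).mono ?_
    intro x hx
    rcases Finset.mem_insert.1 (Finset.mem_coe.1 hx) with rfl | hx
    · exact ⟨hv, hvS⟩
    · exact ⟨hCU hx, hSC x hx⟩
  | step v hv X hk hadj _ ih =>
    obtain ⟨u, hu, huS⟩ : ∃ u ∈ X, u ∉ S := by
      by_contra! hcon
      have := Set.ncard_le_ncard (s := (X : Set V)) (t := S) hcon hfin
      rw [Set.ncard_coe_finset] at this
      omega
    have := ih u hu huS
    exact this.trans (.of_adj this.right_mem ⟨hv, hvS⟩ (hadj u hu))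

/-- A set `U` containing `k` disjoint cores, each of which reaches everything outside `EA` and is
reached by everything outside `EB`, is strongly `k`-connected if all of its vertices are good. -/
theorem stronglyConnOn_of_cores [DecidableEq V] {G : Digr V} {U EA EB : Finset V} {k : ℕ}
    (hk1 : 1 ≤ k) {ι : Type} {I : Finset ι} (hI : k ≤ I.card) (C : ι → Finset V) (x y : ι → V)
    (hdisj : ∀ i ∈ I, ∀ j ∈ I, i ≠ j → Disjoint (C i) (C j))
    (hCU : ∀ i ∈ I, C i ⊆ U)
    (hxy : ∀ i ∈ I, x i ≠ y i) (hreach : ∀ i ∈ I, G.Reaches (C i) (x i) (y i))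
    (hA : ∀ i ∈ I, ∀ v ∈ U, v ∉ EA → G.Reaches (insert v (C i) : Finset V) (y i) v)
    (hB : ∀ i ∈ I, ∀ v ∈ U, v ∉ EB → G.Reaches (insert v (C i) : Finset V) v (x i))
    (hin : ∀ v ∈ U, G.InGood EA U k v) (hout : ∀ v ∈ U, G.rev.InGood EB U k v) :
    G.StronglyConnOn U k := by
  have hcard2 : ∀ i ∈ I, 2 ≤ (C i).card := by
    intro i hi
    have : ({x i, y i} : Finset V) ⊆ C i := by
      intro z hz
      rcases Finset.mem_insert.1 hz with rfl | hz
      · exact Finset.mem_coe.1 (hreach i hi).left_mem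
      · rw [Finset.mem_singleton.1 hz]; exact Finset.mem_coe.1 (hreach i hi).right_mem
    have h2 := Finset.card_le_card this
    rwa [Finset.card_pair (hxy i hi)] at h2
  refine ⟨?_, ?_⟩
  · rw [Set.ncard_coe_finset]
    have h1 : (I.biUnion C).card ≤ U.card := Finset.card_le_card (Finset.biUnion_subset.2 hCU)
    rw [Finset.card_biUnion (fun i hi j hj => hdisj i hi j hj)] at h1
    have h2 := Finset.card_nsmul_le_sum I (fun i => (C i).card) 2 hcard2
    simp only [smul_eq_mul] at h2
    omega
  · intro u hu v hv _ S hS hSk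
    have hfin : S.Finite := U.finite_toSet.subset fun z hz => (hS hz).1
    obtain ⟨i, hi, hiS⟩ : ∃ i ∈ I, ∀ z ∈ C i, z ∉ S := by
      by_contra! hcon
      have : Nonempty V := ⟨u⟩
      choose! f hf hfS using hcon
      have hinj : Set.InjOn f (I : Set ι) := by
        intro i hi j hj hij
        by_contra hne
        exact Finset.disjoint_left.1 (hdisj i hi j hj hne) (hf i hi) (hij ▸ hf j hj)
      have h1 : (I.image f).card = I.card := Finset.card_image_of_injOn hinj
      have h2 := Set.ncard_le_ncard (s := (I.image f : Set V)) (t := S)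
        (by intro z hz; obtain ⟨i, hi, rfl⟩ := by simpa using hz
            exact hfS i hi) hfin
      rw [Set.ncard_coe_finset] at h2
      omega
    have huS : u ∉ S := fun h => (hS h).2 (by simp)
    have hvS : v ∉ S := fun h => (hS h).2 (by simp)
    have h1 : G.Reaches (↑U \ S) u (x i) :=
      ((hout u hu).reaches (hCU i hi) (fun w hw hwE => (hB i hi w hw hwE).rev) hfin hSk hiS huS).rev
    have h2 : G.Reaches (↑U \ S) (x i) (y i) :=
      (hreach i hi).mono fun z hz => ⟨hCU i hi hz, hiS z hz⟩
    have h3 := (hin v hv).reaches (hCU i hi) (hA i hi) hfin hSk hiS hvS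
    exact (h1.trans h2).trans h3

end Digr

namespace Digr

open scoped Classical

variable {V : Type}

theorem IsTournament.exists_card_in_le_half {G : Digr V} (hG : G.IsTournament) {U : Finset V}
    (hU : U.Nonempty) : ∃ x ∈ U, 2 * (U.filter fun u => G.Adj u x).card ≤ U.card := by
  by_contra! hcon
  have h1 : ∑ x ∈ U, (U.filter fun u => G.Adj x u).card
      = ∑ x ∈ U, (U.filter fun u => G.Adj u x).card :=
    Finset.sum_card_bipartiteAbove_eq_sum_card_bipartiteBelow G.Adj
  have h2 : ∀ x ∈ U, (U.filter fun u => G.Adj x u).card + (U.filter fun u => G.Adj u x).card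
      ≤ U.card := by
    intro x _
    rw [← Finset.card_union_of_disjoint]
    · exact Finset.card_le_card (by intro z; simp; tauto)
    · exact Finset.disjoint_filter.2 fun y _ h => hG.asymm h
  have h3 := Finset.sum_le_sum h2
  have h4 := Finset.sum_lt_sum_of_nonempty hU hcon
  rw [Finset.sum_add_distrib, h1] at h3
  rw [← Finset.mul_sum] at h4
  omega

variable [Fintype V]

/-- The in-neighbourhood of `v` as a finite set. -/
noncomputable def inNbr (G : Digr V) (v : V) : Finset V := Finset.univ.filter fun u => G.Adj u v

/-- The set of vertices all of whose edges to `A` go towards `A`. -/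
noncomputable def undom (G : Digr V) (A : Finset V) : Finset V :=
  Finset.univ.filter fun u => ∀ x ∈ A, G.Adj u x

/-- `s` is a source of `A`: it lies in `A` and dominates the other vertices of `A`. -/
def IsSource (G : Digr V) (A : Finset V) (s : V) : Prop := s ∈ A ∧ ∀ x ∈ A, x ≠ s → G.Adj s x

@[simp] theorem mem_inNbr {G : Digr V} {u v : V} : u ∈ G.inNbr v ↔ G.Adj u v := by simp [inNbr]

@[simp] theorem mem_undom {G : Digr V} {A : Finset V} {u : V} :
    u ∈ G.undom A ↔ ∀ x ∈ A, G.Adj u x := by simp [undom]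

theorem IsSource.reaches {G : Digr V} (hG : G.IsTournament) {A : Finset V} {s v : V}
    (hs : G.IsSource A s) (hv : v ∉ G.undom A) :
    G.Reaches (insert v A : Finset V) s v := by
  have hsin : s ∈ ((insert v A : Finset V) : Set V) := by simp [hs.1]
  have key : ∀ x ∈ A, G.Reaches (insert v A : Finset V) s x := by
    intro x hx
    by_cases hxs : x = s
    · rw [hxs]; exact .refl hsin
    · exact .of_adj hsin (by simp [hx]) (hs.2 x hx hxs)
  by_cases hvA : v ∈ A
  · exact key v hvA
  · simp only [mem_undom, not_forall] at hv
    obtain ⟨x, hx, hvx⟩ := hv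
    have hne : x ≠ v := by rintro rfl; exact hvA hx
    exact (key x hx).trans (.of_adj (by simp [hx]) (by simp) (hG.adj_of_not hne hvx))

/-- A vertex `a` extends to a small set `A` with a source, which avoids `F` and dominates all but
few of the vertices outside `F`. -/
theorem IsTournament.exists_dominating {G : Digr V} (hG : G.IsTournament) {F : Finset V} {a : V}
    (ha : a ∉ F) (c : ℕ) : ∃ (A : Finset V) (s : V), a ∈ A ∧ Disjoint A F ∧ A.card ≤ c + 1 ∧
      G.IsSource A s ∧ 2 ^ c * (G.undom A \ F).card ≤ (G.inNbr a).card := by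
  induction c with
  | zero =>
    refine ⟨{a}, a, by simp, by simpa using ha, by simp, ⟨by simp, by simp⟩, ?_⟩
    simp only [pow_zero, one_mul]
    exact Finset.card_le_card (by intro z; simp; tauto)
  | succ c ih =>
    obtain ⟨A, s, haA, hAF, hAc, hs, hcard⟩ := ih
    rcases (G.undom A \ F).eq_empty_or_nonempty with h0 | hne
    · exact ⟨A, s, haA, hAF, by omega, hs, by simp [h0]⟩
    · obtain ⟨x, hx, hxU⟩ := hG.exists_card_in_le_half hne
      simp only [Finset.mem_sdiff, mem_undom] at hx
      refine ⟨insert x A, x, by simp [haA], ?_, ?_, ⟨by simp, ?_⟩, ?_⟩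
      · rw [Finset.disjoint_insert_left]; exact ⟨hx.2, hAF⟩
      · exact (Finset.card_insert_le _ _).trans (by omega)
      · intro y hy hyx
        exact hx.1 y (Finset.mem_of_mem_insert_of_ne hy hyx)
      · have : G.undom (insert x A) \ F ⊆ (G.undom A \ F).filter fun u => G.Adj u x := by
          intro z; simp; tauto
        have := Finset.card_le_card this
        calc 2 ^ (c + 1) * (G.undom (insert x A) \ F).card
            = 2 ^ c * (2 * (G.undom (insert x A) \ F).card) := by ring
          _ ≤ 2 ^ c * (G.undom A \ F).card := Nat.mul_le_mul_left _ (by omega)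
          _ ≤ _ := hcard

theorem IsTournament.exists_dominating_family {G : Digr V} (hG : G.IsTournament) (c D : ℕ)
    (C : Finset V) (hD : ∀ a ∈ C, (G.inNbr a).card ≤ D) :
    ∀ F : Finset V, Disjoint C F → ∃ (S : Finset V) (A : V → Finset V), S.card = C.card ∧
      C ⊆ S.biUnion A ∧ (∀ s ∈ S, G.IsSource (A s) s) ∧ (∀ s ∈ S, (A s).card ≤ c + 1) ∧
      (∀ s ∈ S, ∀ s' ∈ S, s ≠ s' → Disjoint (A s) (A s')) ∧ (∀ s ∈ S, Disjoint (A s) F) ∧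
      ∀ s ∈ S, 2 ^ c * (G.undom (A s) \ (F ∪ S.biUnion A)).card ≤ D := by
  induction C using Finset.induction_on with
  | empty => exact fun F _ => ⟨∅, fun _ => ∅, by simp⟩
  | @insert a C haC ih =>
    intro F hF
    rw [Finset.disjoint_insert_left] at hF
    obtain ⟨S, A, h1, h2, h3, h4, h5, h6, h7⟩ := ih (fun a ha => hD a (by simp [ha])) (insert a F)
      (by rw [Finset.disjoint_insert_right]; exact ⟨haC, hF.2⟩)
    have haF : a ∉ F ∪ S.biUnion A := by
      simp only [Finset.mem_union, Finset.mem_biUnion, not_or, not_exists, not_and]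
      exact ⟨hF.1, fun s hs has => Finset.disjoint_left.1 (h6 s hs) has (by simp)⟩
    obtain ⟨A₀, s₀, haA, hAF, hAc, hs₀, hcard⟩ := hG.exists_dominating haF c
    rw [Finset.disjoint_union_right, Finset.disjoint_biUnion_right] at hAF
    have hs₀S : s₀ ∉ S := fun h =>
      Finset.disjoint_left.1 (hAF.2 s₀ h) hs₀.1 (h3 s₀ h).1
    have hA' : ∀ s ∈ S, Function.update A s₀ A₀ s = A s := fun s hs =>
      Function.update_of_ne (by rintro rfl; exact hs₀S hs) _ _
    have hA₀ : Function.update A s₀ A₀ s₀ = A₀ := Function.update_self _ _ _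
    have hU : (insert s₀ S).biUnion (Function.update A s₀ A₀) = A₀ ∪ S.biUnion A := by
      rw [Finset.biUnion_insert, hA₀, Finset.biUnion_congr rfl hA']
    refine ⟨insert s₀ S, Function.update A s₀ A₀, ?_, ?_, ?_, ?_, ?_, ?_, ?_⟩
    · rw [Finset.card_insert_of_notMem hs₀S, Finset.card_insert_of_notMem haC, h1]
    · rw [hU]
      intro z hz
      rcases Finset.mem_insert.1 hz with rfl | hz
      · exact Finset.mem_union_left _ haA
      · exact Finset.mem_union_right _ (h2 hz)
    · intro s hs
      rcases Finset.mem_insert.1 hs with rfl | hs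
      · rwa [hA₀]
      · rw [hA' s hs]; exact h3 s hs
    · intro s hs
      rcases Finset.mem_insert.1 hs with rfl | hs
      · rwa [hA₀]
      · rw [hA' s hs]; exact h4 s hs
    · intro s hs s' hs' hne
      rcases Finset.mem_insert.1 hs with rfl | hs₁ <;> rcases Finset.mem_insert.1 hs' with rfl | hs₂
      · exact absurd rfl hne
      · rw [hA₀, hA' s' hs₂]; exact hAF.2 s' hs₂
      · rw [hA₀, hA' s hs₁]; exact (hAF.2 s hs₁).symm
      · rw [hA' s hs₁, hA' s' hs₂]; exact h5 s hs₁ s' hs₂ hne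
    · intro s hs
      rcases Finset.mem_insert.1 hs with rfl | hs
      · rw [hA₀]; exact hAF.1
      · rw [hA' s hs]; exact (Finset.disjoint_insert_right.1 (h6 s hs)).2
    · intro s hs
      rw [hU]
      rcases Finset.mem_insert.1 hs with rfl | hs
      · rw [hA₀]
        refine le_trans (Nat.mul_le_mul_left _ (Finset.card_le_card ?_))
          (hcard.trans (hD a (by simp)))
        intro z; simp; tauto
      · rw [hA' s hs]
        refine le_trans (Nat.mul_le_mul_left _ (Finset.card_le_card ?_)) (h7 s hs)
        intro z
        simp only [Finset.mem_sdiff, Finset.mem_union, Finset.mem_insert, not_or]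
        rintro ⟨hz, hzF, hzA, hzS⟩
        exact ⟨hz, ⟨by rintro rfl; exact hzA haA, hzF⟩, hzS⟩

/-- The `m` vertices outside `F` with the smallest values of `f`. -/
theorem exists_lowest (f : V → ℕ) (F : Finset V) (m : ℕ) (hm : m + F.card ≤ Fintype.card V) :
    ∃ (C : Finset V) (D : ℕ), Disjoint C F ∧ C.card = m ∧ (∀ x ∈ C, f x ≤ D) ∧
      (∀ y, y ∉ C → y ∉ F → D ≤ f y) ∧ (m = 0 ∨ ∃ x ∈ C, f x = D) := by
  induction m with
  | zero => exact ⟨∅, 0, by simp⟩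
  | succ m ih =>
    obtain ⟨C, D, h1, h2, h3, h4, -⟩ := ih (by omega)
    have hne : ((C ∪ F)ᶜ : Finset V).Nonempty := by
      rw [← Finset.card_pos, Finset.card_compl]
      have := Finset.card_union_le C F
      omega
    obtain ⟨y, hy, hmin⟩ := Finset.exists_min_image _ f hne
    simp only [Finset.mem_compl, Finset.mem_union, not_or] at hy hmin
    refine ⟨insert y C, f y, ?_, ?_, ?_, ?_, Or.inr ⟨y, by simp, rfl⟩⟩
    · rw [Finset.disjoint_insert_left]; exact ⟨hy.2, h1⟩
    · rw [Finset.card_insert_of_notMem hy.1, h2]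
    · intro x hx
      rcases Finset.mem_insert.1 hx with rfl | hx
      · exact le_rfl
      · exact (h3 x hx).trans (h4 y hy.1 hy.2)
    · intro z hz hzF
      exact hmin z ⟨fun h => hz (by simp [h]), hzF⟩

end Digr

namespace Digr

open scoped Classical

variable {V : Type}

/-- A family of pairwise disjoint paths of `G` inside `Y`, each from a vertex of `P` to a vertex
of `Q`. -/
def IsLinkage (G : Digr V) (Y P Q : Finset V) {p : ℕ} (L : Fin p → List V) : Prop :=
  (∀ i, ∃ x ∈ P, ∃ y ∈ Q, G.IsPathOn Y x y (L i)) ∧ ∀ i j, i ≠ j → (L i).Disjoint (L j)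

/-- The successor relation whose transversals encode linkages with `p` paths. -/
inductive LinkRel (G : Digr V) (Y P Q : Finset V) (p : ℕ) : V ⊕ Fin p → V ⊕ Fin p → Prop
  | stay (v : V) : LinkRel G Y P Q p (.inl v) (.inl v)
  | move (v w : V) (h : G.Adj v w) (hv : v ∈ Y) (hw : w ∈ Y) : LinkRel G Y P Q p (.inl v) (.inl w)
  | enter (i : Fin p) (v : V) (hv : v ∈ P) : LinkRel G Y P Q p (.inr i) (.inl v)
  | leave (v : V) (i : Fin p) (hv : v ∈ Q) : LinkRel G Y P Q p (.inl v) (.inr i)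

theorem exists_linkRel_injective [Fintype V] {G : Digr V} {Y P Q : Finset V} {p : ℕ}
    (hsep : ∀ S : Finset V, S.card < p → ∃ x ∈ P \ S, ∃ y ∈ Q \ S, G.Reaches (↑Y \ ↑S) x y) :
    ∃ f : V ⊕ Fin p → V ⊕ Fin p, Function.Injective f ∧ ∀ a, LinkRel G Y P Q p a (f a) := by
  have hall := (Finset.all_card_le_biUnion_card_iff_exists_injective
    (fun a : V ⊕ Fin p => Finset.univ.filter fun b => LinkRel G Y P Q p a b)).1 ?_
  · obtain ⟨f, hf, hf'⟩ := hall
    exact ⟨f, hf, fun a => by simpa using hf' a⟩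
  intro X
  set N := X.biUnion fun a => Finset.univ.filter fun b => LinkRel G Y P Q p a b with hN
  have hmemN : ∀ a ∈ X, ∀ b, LinkRel G Y P Q p a b → b ∈ N := by
    intro a ha b hab
    simp only [hN, Finset.mem_biUnion, Finset.mem_filter, Finset.mem_univ, true_and]
    exact ⟨a, ha, hab⟩
  have hXc := Finset.card_toLeft_add_card_toRight (u := X)
  have hNc := Finset.card_toLeft_add_card_toRight (u := N)
  have hsub : X.toLeft ⊆ N.toLeft := by
    intro v hv
    rw [Finset.mem_toLeft] at hv ⊢
    exact hmemN _ hv _ (.stay v)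
  have hle := Finset.card_le_card hsub
  have hR : X.toRight.card ≤ p := by simpa using Finset.card_le_univ X.toRight
  by_cases hX1 : X.toRight = ∅
  · rw [hX1, Finset.card_empty] at hXc
    omega
  by_cases hXQ : ∃ v ∈ X.toLeft, v ∈ Q
  · obtain ⟨v, hv, hvQ⟩ := hXQ
    have : N.toRight = Finset.univ := by
      ext i
      simpa using hmemN _ (Finset.mem_toLeft.1 hv) _ (.leave v i hvQ)
    rw [this, Finset.card_univ, Fintype.card_fin] at hNc
    omega
  by_contra hlt
  have hSc := Finset.card_sdiff_add_card_eq_card hsub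
  obtain ⟨x, hx, y, hy, hxy⟩ := hsep (N.toLeft \ X.toLeft) (by omega)
  obtain ⟨hxY, hR⟩ := reaches_iff.1 hxy
  obtain ⟨i, hi⟩ := Finset.nonempty_iff_ne_empty.2 hX1
  simp only [Finset.mem_sdiff, not_and, not_not] at hx hy
  have hinv : y ∈ X.toLeft ∧ y ∈ Y := by
    clear hy
    induction hR with
    | refl =>
      exact ⟨hx.2 (Finset.mem_toLeft.2 (hmemN _ (Finset.mem_toRight.1 hi) _ (.enter i x hx.1))),
        hxY.1⟩
    | @tail b c _ hbc ih =>
      obtain ⟨hb, hbY⟩ := ih (reaches_iff.2 ⟨hxY, by assumption⟩)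
      have hcN : c ∈ N.toLeft :=
        Finset.mem_toLeft.2 (hmemN _ (Finset.mem_toLeft.1 hb) _ (.move b c hbc.1 hbY hbc.2.1))
      refine ⟨?_, hbc.2.1⟩
      by_contra hc
      exact hbc.2.2 (by simp [hcN, hc])
  exact hXQ ⟨y, hinv.1, hy.1⟩

/-- Menger's theorem for vertex-disjoint paths between two sets of vertices of a digraph. -/
theorem exists_linkage [Fintype V] {G : Digr V} {Y P Q : Finset V} {p : ℕ} (hPY : P ⊆ Y)
    (hsep : ∀ S : Finset V, S.card < p → ∃ x ∈ P \ S, ∃ y ∈ Q \ S, G.Reaches (↑Y \ ↑S) x y) :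
    ∃ L : Fin p → List V, G.IsLinkage Y P Q L := by
  obtain ⟨f, hf, hrel⟩ := exists_linkRel_injective hsep
  have hex : ∀ i : Fin p, ∃ n, ∃ j, f^[n + 1] (.inr i) = .inr j := by
    intro i
    obtain ⟨n, hn, hper⟩ := hf.mem_periodicPts (Sum.inr i)
    exact ⟨n - 1, i, by rw [Nat.sub_add_cancel hn]; exact hper⟩
  have hlast : ∀ i, ∃ j, f^[Nat.find (hex i) + 1] (.inr i) = .inr j := fun i => Nat.find_spec (hex i)
  have hmin : ∀ i n, n < Nat.find (hex i) → ∀ j, f^[n + 1] (.inr i) ≠ .inr j :=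
    fun i n hn j h => Nat.find_min (hex i) hn ⟨j, h⟩
  generalize hNdef : (fun i => Nat.find (hex i)) = N at hlast hmin
  simp only [funext_iff] at hNdef
  simp only [hNdef] at hlast hmin
  have hw' : ∀ i n, ∃ w, n < N i → f^[n + 1] (.inr i) = .inl w := by
    intro i n
    by_cases hn : n < N i
    · rcases h : f^[n + 1] (Sum.inr i) with w | j
      · exact ⟨w, fun _ => rfl⟩
      · exact absurd h (hmin i n hn j)
    · have : ∃ v : V, v ∈ P := by
        have := hrel (.inr i)
        generalize f (.inr i) = b at this
        cases this with
        | enter _ v hv => exact ⟨v, hv⟩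
      exact ⟨this.choose, fun h => absurd h hn⟩
  choose w hw using hw'
  have hpos : ∀ i, 0 < N i := by
    intro i
    by_contra h0
    obtain ⟨j, hj⟩ := hlast i
    have := hrel (.inr i)
    rw [show N i = 0 by omega] at hj
    simp only [zero_add, Function.iterate_one] at hj
    rw [hj] at this
    cases this
  have hinj' : ∀ i j n m, n ≤ m → n < N i → m < N j → w i n = w j m → n = m ∧ i = j := by
    intro i j n m hnm hn hm h
    have h1 : f^[n + 1] (.inr i) = f^[n + 1] (f^[m - n] (.inr j)) := by
      rw [hw i n hn, ← Function.iterate_add_apply, show n + 1 + (m - n) = m + 1 by omega,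
        hw j m hm, h]
    have h2 := (hf.iterate _) h1
    rcases Nat.eq_or_lt_of_le hnm with rfl | hlt
    · simp only [Nat.sub_self, Function.iterate_zero, id, Sum.inr.injEq] at h2
      exact ⟨rfl, h2⟩
    · refine absurd h2.symm ?_
      rw [show m - n = (m - n - 1) + 1 by omega]
      exact hmin j _ (by omega) i
  have hinj : ∀ i j n m, n < N i → m < N j → w i n = w j m → n = m ∧ i = j := by
    intro i j n m hn hm h
    rcases le_total n m with hnm | hnm
    · exact hinj' i j n m hnm hn hm h
    · obtain ⟨h1, h2⟩ := hinj' j i m n hnm hm hn h.symm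
      exact ⟨h1.symm, h2.symm⟩
  have hstep : ∀ i n, n + 1 < N i → G.Adj (w i n) (w i (n + 1)) ∧ w i (n + 1) ∈ Y := by
    intro i n hn
    have h1 := hw i n (by omega)
    have h2 := hw i (n + 1) hn
    rw [Function.iterate_succ_apply', h1] at h2
    have h3 := hrel (.inl (w i n))
    rw [h2] at h3
    have hne : w i n ≠ w i (n + 1) := fun h => by
      have := (hinj i i n (n + 1) (by omega) hn h).1
      omega
    generalize w i n = a at *
    generalize w i (n + 1) = b at *
    cases h3 with
    | stay => exact absurd rfl hne
    | move _ _ h _ hY => exact ⟨h, hY⟩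
  have hfirst : ∀ i, w i 0 ∈ P := by
    intro i
    have h1 := hw i 0 (hpos i)
    have h2 := hrel (.inr i)
    simp only [zero_add, Function.iterate_one] at h1
    rw [h1] at h2
    generalize w i 0 = a at *
    cases h2 with
    | enter _ _ h => exact h
  have hend : ∀ i, w i (N i - 1) ∈ Q := by
    intro i
    have h1 := hw i (N i - 1) (by have := hpos i; omega)
    obtain ⟨j, h2⟩ := hlast i
    rw [Nat.sub_add_cancel (hpos i)] at h1
    rw [Function.iterate_succ_apply', h1] at h2
    have h3 := hrel (.inl (w i (N i - 1)))
    rw [h2] at h3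
    generalize w i (N i - 1) = a at *
    cases h3 with
    | leave _ _ h => exact h
  refine ⟨fun i => (List.range (N i)).map (w i), fun i => ⟨w i 0, hfirst i, w i (N i - 1), hend i,
    ?_, ?_, ?_, ?_, ?_⟩, ?_⟩
  · refine List.Nodup.map_on ?_ List.nodup_range
    intro n hn m hm h
    exact (hinj i i n m (List.mem_range.1 hn) (List.mem_range.1 hm) h).1
  · refine List.isChain_iff_getElem.2 ?_
    intro n hn
    simp only [List.length_map, List.length_range] at hn
    simpa using (hstep i n hn).1
  · intro x hx
    obtain ⟨n, hn, rfl⟩ := List.mem_map.1 hx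
    cases n with
    | zero => exact hPY (hfirst i)
    | succ n => exact (hstep i n (List.mem_range.1 hn)).2
  · simp [List.head?_range, (hpos i).ne']
  · simp [List.getLast?_range, (hpos i).ne']
  · intro i j hij x hx hx'
    obtain ⟨n, hn, rfl⟩ := List.mem_map.1 hx
    obtain ⟨m, hm, h⟩ := List.mem_map.1 hx'
    exact hij (hinj i j n m (List.mem_range.1 hn) (List.mem_range.1 hm) h.symm).2

/-- A linkage of minimal total length: no path can be replaced by a shorter one that is disjoint
from the others. -/
theorem exists_minimal_linkage {G : Digr V} {Y P Q : Finset V} {p : ℕ}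
    (h : ∃ L : Fin p → List V, G.IsLinkage Y P Q L) :
    ∃ L : Fin p → List V, G.IsLinkage Y P Q L ∧ ∀ i, ∀ x ∈ P, ∀ y ∈ Q, ∀ l, G.IsPathOn Y x y l →
      (∀ j, j ≠ i → l.Disjoint (L j)) → (L i).length ≤ l.length := by
  obtain ⟨L, hL, hmin⟩ := exists_minimalFor_of_wellFoundedLT (G.IsLinkage Y P Q)
    (fun L : Fin p → List V => ∑ i, (L i).length) h
  refine ⟨L, hL, fun i x hx y hy l hl hdisj => ?_⟩
  by_contra! hlt
  have hlink : G.IsLinkage Y P Q (Function.update L i l) := by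
    refine ⟨fun j => ?_, fun j j' hne => ?_⟩
    · by_cases hj : j = i
      · subst hj; rw [Function.update_self]; exact ⟨x, hx, y, hy, hl⟩
      · rw [Function.update_of_ne hj]; exact hL.1 j
    · by_cases hj : j = i
      · subst hj; rw [Function.update_self, Function.update_of_ne hne.symm]
        exact hdisj j' hne.symm
      · rw [Function.update_of_ne hj]
        by_cases hj' : j' = i
        · subst hj'; rw [Function.update_self]; exact (hdisj j hj).symm
        · rw [Function.update_of_ne hj']; exact hL.2 j j' hne
  have hsum : ∑ j, (Function.update L i l j).length < ∑ j, (L j).length := by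
    refine Finset.sum_lt_sum (fun j _ => ?_) ⟨i, Finset.mem_univ i, by simpa using hlt⟩
    by_cases hj : j = i
    · subst hj; simpa using hlt.le
    · rw [Function.update_of_ne hj]
  have := hmin hlink hsum.le
  exact absurd this (by simpa using hsum)

end Digr

namespace Digr

open scoped Classical

variable {V : Type}

theorem exists_disjoint_selection {ι : Type} (P : Finset ι) (N : ι → Finset V) (k n : ℕ)
    (hn : k * P.card ≤ n) (hN : ∀ i ∈ P, n ≤ (N i).card) :
    ∃ φ : ι → Finset V, (∀ i ∈ P, φ i ⊆ N i ∧ (φ i).card = k) ∧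
      ∀ i ∈ P, ∀ j ∈ P, i ≠ j → Disjoint (φ i) (φ j) := by
  induction P using Finset.induction_on with
  | empty => exact ⟨fun _ => ∅, by simp, by simp⟩
  | insert a P ha ih =>
    rw [Finset.card_insert_of_notMem ha, mul_add, mul_one] at hn
    obtain ⟨φ, h1, h2⟩ := ih (by omega) fun i hi => hN i (by simp [hi])
    have hc : (P.biUnion φ).card ≤ k * P.card := by
      rw [mul_comm]
      exact Finset.card_biUnion_le_card_mul _ _ _ fun i hi => (h1 i hi).2.le
    have hk : k ≤ (N a \ P.biUnion φ).card := by
      have := Finset.le_card_sdiff (P.biUnion φ) (N a)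
      have := hN a (by simp)
      omega
    obtain ⟨Z, hZ, hZk⟩ := Finset.exists_subset_card_eq hk
    have hdis : ∀ i ∈ P, Disjoint Z (φ i) := by
      intro i hi
      refine Finset.disjoint_left.2 fun z hz hz' => ?_
      exact (Finset.mem_sdiff.1 (hZ hz)).2 (Finset.mem_biUnion.2 ⟨i, hi, hz'⟩)
    have hne : ∀ i ∈ P, i ≠ a := fun i hi => by rintro rfl; exact ha hi
    refine ⟨Function.update φ a Z, ?_, ?_⟩
    · intro i hi
      rcases Finset.mem_insert.1 hi with rfl | hi
      · simpa [hZk] using hZ.trans Finset.sdiff_subset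
      · simpa [hne i hi] using h1 i hi
    · intro i hi j hj hij
      rcases Finset.mem_insert.1 hi with rfl | hi' <;> rcases Finset.mem_insert.1 hj with rfl | hj'
      · exact absurd rfl hij
      · simpa [hne j hj'] using hdis j hj'
      · simpa [hne i hi'] using (hdis i hi').symm
      · simpa [hne i hi', hne j hj'] using h2 i hi' j hj' hij

/-- Add to `W` private sets of `k` vertices for the members of `P`, and extend the map `r` so
that it is constant on every member of `P` together with its private set. -/
theorem exists_private_extension (W P : Finset V) (r : V → V) (N : V → Finset V) (k : ℕ)
    (hN : ∀ x ∈ P, W.card + k * P.card ≤ (N x).card) :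
    ∃ (W' : Finset V) (r' : V → V) (φ : V → Finset V), W ⊆ W' ∧ (∀ y ∈ W, r' y = r y) ∧
      W'.card ≤ W.card + k * P.card ∧
      (∀ x ∈ P, (φ x).card = k ∧ ∀ y ∈ φ x, y ∈ N x ∧ y ∉ W ∧ y ∈ W' ∧ r' y = r x) ∧
      ∀ y ∈ W', y ∉ W → ∃ x ∈ P, y ∈ φ x := by
  obtain ⟨φ, h1, h2⟩ := exists_disjoint_selection P (fun x => N x \ W) k (k * P.card) le_rfl (by
    intro x hx
    have := hN x hx
    have := Finset.le_card_sdiff W (N x)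
    omega)
  have hr : ∀ x ∈ P, ∀ y ∈ φ x, (y ∉ W) ∧ ∀ x' ∈ P, y ∈ φ x' → x' = x := by
    intro x hx y hy
    refine ⟨(Finset.mem_sdiff.1 ((h1 x hx).1 hy)).2, fun x' hx' hy' => ?_⟩
    by_contra hne
    exact Finset.disjoint_left.1 (h2 x' hx' x hx hne) hy' hy
  refine ⟨W ∪ P.biUnion φ, fun y => if h : ∃ x ∈ P, y ∈ φ x then r h.choose else r y, φ,
    Finset.subset_union_left, ?_, ?_, ?_, ?_⟩
  · intro y hy
    refine dif_neg ?_
    rintro ⟨x, hx, hxy⟩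
    exact (hr x hx y hxy).1 hy
  · refine (Finset.card_union_le _ _).trans (Nat.add_le_add_left ?_ _)
    rw [mul_comm]
    exact Finset.card_biUnion_le_card_mul _ _ _ fun i hi => (h1 i hi).2.le
  · intro x hx
    refine ⟨(h1 x hx).2, fun y hy => ?_⟩
    have hyN := Finset.mem_sdiff.1 ((h1 x hx).1 hy)
    have hex : ∃ x ∈ P, y ∈ φ x := ⟨x, hx, hy⟩
    refine ⟨hyN.1, hyN.2, Finset.mem_union_right _ (Finset.mem_biUnion.2 hex), ?_⟩
    simp only [dif_pos hex]
    rw [(hr x hx y hy).2 _ hex.choose_spec.1 hex.choose_spec.2]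
  · intro y hy hyW
    rcases Finset.mem_union.1 hy with h | h
    · exact absurd h hyW
    · exact Finset.mem_biUnion.1 h

variable [Fintype V]

theorem exists_closure_aux {G : Digr V} {EA EB L X : Finset V} {k M : ℕ}
    (hk : 1 ≤ k) (hLX : L ⊆ X) (hL : L.card ≤ 28 * k) (hX : X.card ≤ 186 * k ^ 2)
    (hM : 242 * k ^ 2 * (k + 1) ^ 2 ≤ M)
    (hin : ∀ v, M ≤ (G.inNbr v).card) (hout : ∀ v, M ≤ (G.rev.inNbr v).card)
    (hinE : ∀ v, v ∉ L → M ≤ (G.inNbr v \ EA).card)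
    (houtE : ∀ v, v ∉ L → M ≤ (G.rev.inNbr v \ (EA ∪ EB)).card) :
    ∃ (W : Finset V) (r : V → V), X ⊆ W ∧ (∀ x ∈ W, r x ∈ X) ∧ (∀ x ∈ X, r x = x) ∧
      W.card ≤ 242 * k ^ 2 * (k + 1) ^ 2 ∧
      ∀ x ∈ W, G.InGood EA (W.filter fun y => r y = r x) k x ∧
        G.rev.InGood EB (W.filter fun y => r y = r x) k x := by
  have hkL : k * L.card ≤ 28 * k ^ 2 := by nlinarith
  have hkk : 242 * k ^ 2 * (k + 1) ≤ 242 * k ^ 2 * (k + 1) ^ 2 := by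
    rw [pow_two (k + 1), ← mul_assoc]; exact Nat.le_mul_of_pos_right _ (by omega)
  have hkk' : 242 * k ^ 2 ≤ 242 * k ^ 2 * (k + 1) := Nat.le_mul_of_pos_right _ (by omega)
  obtain ⟨Wa, ra, φa, ha1, ha2, ha3, ha4, ha5⟩ := exists_private_extension X L id G.inNbr k
    fun x _ => le_trans (by omega) (hin x)
  obtain ⟨Wb, rb, φb, hb1, hb2, hb3, hb4, hb5⟩ := exists_private_extension Wa L ra G.rev.inNbr k
    fun x _ => le_trans (by omega) (hout x)
  have hcb : Wb.card ≤ 242 * k ^ 2 := by omega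
  have hPb : (Wb \ L).card ≤ Wb.card := Finset.card_le_card Finset.sdiff_subset
  have hPb' := Nat.mul_le_mul_left k hPb
  have hcb' : Wb.card + k * (Wb \ L).card ≤ 242 * k ^ 2 * (k + 1) := by nlinarith
  obtain ⟨Wc, rc, φc, hc1, hc2, hc3, hc4, hc5⟩ := exists_private_extension Wb (Wb \ L) rb
    (fun v => G.inNbr v \ EA) k
    fun x hx => le_trans (by omega) (hinE x (Finset.mem_sdiff.1 hx).2)
  have hPc : (Wc \ L).card ≤ Wc.card := Finset.card_le_card Finset.sdiff_subset
  have hPc' := Nat.mul_le_mul_left k hPc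
  have hcc' : Wc.card + k * (Wc \ L).card ≤ 242 * k ^ 2 * (k + 1) ^ 2 := by nlinarith
  obtain ⟨W, r, φ, hd1, hd2, hd3, hd4, hd5⟩ := exists_private_extension Wc (Wc \ L) rc
    (fun v => G.rev.inNbr v \ (EA ∪ EB)) k
    fun x hx => le_trans (by omega) (houtE x (Finset.mem_sdiff.1 hx).2)
  have hXW : X ⊆ W := ha1.trans (hb1.trans (hc1.trans hd1))
  have hra : ∀ y ∈ Wa, r y = ra y := fun y hy => by
    rw [hd2 y (hc1 (hb1 hy)), hc2 y (hb1 hy), hb2 y hy]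
  have hrb : ∀ y ∈ Wb, r y = rb y := fun y hy => by rw [hd2 y (hc1 hy), hc2 y hy]
  have hrX : ∀ y ∈ X, r y = y := fun y hy => by rw [hra y (ha1 hy), ha2 y hy, id]
  have hra' : ∀ y ∈ Wa, r y ∈ X := by
    intro y hy
    by_cases hyX : y ∈ X
    · rwa [hrX y hyX]
    · obtain ⟨x, hx, hxy⟩ := ha5 y hy hyX
      rw [hra y hy, ((ha4 x hx).2 y hxy).2.2.2]
      exact hLX hx
  have hrb' : ∀ y ∈ Wb, r y ∈ X := by
    intro y hy
    by_cases hya : y ∈ Wa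
    · exact hra' y hya
    · obtain ⟨x, hx, hxy⟩ := hb5 y hy hya
      rw [hrb y hy, ((hb4 x hx).2 y hxy).2.2.2, ← hra x (ha1 (hLX hx))]
      exact hra' x (ha1 (hLX hx))
  have hrc' : ∀ y ∈ Wc, r y ∈ X := by
    intro y hy
    by_cases hyb : y ∈ Wb
    · exact hrb' y hyb
    · obtain ⟨x, hx, hxy⟩ := hc5 y hy hyb
      have hxb := (Finset.mem_sdiff.1 hx).1
      rw [hd2 y hy, ((hc4 x hx).2 y hxy).2.2.2, ← hrb x hxb]
      exact hrb' x hxb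
  have hr' : ∀ y ∈ W, r y ∈ X := by
    intro y hy
    by_cases hyc : y ∈ Wc
    · exact hrc' y hyc
    · obtain ⟨x, hx, hxy⟩ := hd5 y hy hyc
      have hxc := (Finset.mem_sdiff.1 hx).1
      rw [((hd4 x hx).2 y hxy).2.2.2, ← hd2 x hxc]
      exact hrc' x hxc
  have hinbase : ∀ x ∈ W, x ∉ EA → G.InGood EA (W.filter fun y => r y = r x) k x :=
    fun x hx hxE => .base x (by simp [hx]) hxE
  have houtbase : ∀ x ∈ W, x ∉ EB → G.rev.InGood EB (W.filter fun y => r y = r x) k x :=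
    fun x hx hxE => .base x (by simp [hx]) hxE
  have hmain : ∀ x ∈ W, x ∉ L → G.InGood EA (W.filter fun y => r y = r x) k x ∧
      G.rev.InGood EB (W.filter fun y => r y = r x) k x := by
    intro x hx hxL
    by_cases hxc : x ∈ Wc
    · have hxP : x ∈ Wc \ L := Finset.mem_sdiff.2 ⟨hxc, hxL⟩
      obtain ⟨hk1, hk2⟩ := hd4 x hxP
      refine ⟨?_, ?_⟩
      · by_cases hxb : x ∈ Wb
        · have hxP : x ∈ Wb \ L := Finset.mem_sdiff.2 ⟨hxb, hxL⟩
          obtain ⟨hk1, hk2⟩ := hc4 x hxP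
          refine .step x (by simp [hx]) (φc x) hk1.ge (fun u hu => ?_) fun u hu => ?_
          · simpa using (Finset.mem_sdiff.1 (hk2 u hu).1).1
          · have h := hk2 u hu
            have hru : r u = r x := by rw [hd2 u h.2.2.1, h.2.2.2, hrb x hxb]
            have := hinbase u (hd1 h.2.2.1) (Finset.mem_sdiff.1 h.1).2
            rwa [hru] at this
        · obtain ⟨z, hz, hzx⟩ := hc5 x hxc hxb
          exact hinbase x hx (Finset.mem_sdiff.1 ((hc4 z hz).2 x hzx).1).2
      · refine .step x (by simp [hx]) (φ x) hk1.ge (fun u hu => ?_) fun u hu => ?_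
        · simpa using (Finset.mem_sdiff.1 (hk2 u hu).1).1
        · have h := hk2 u hu
          have hru : r u = r x := by rw [h.2.2.2, hd2 x hxc]
          have := houtbase u h.2.2.1
            fun hB => (Finset.mem_sdiff.1 h.1).2 (Finset.mem_union_right _ hB)
          rwa [hru] at this
    · obtain ⟨z, hz, hzx⟩ := hd5 x hx hxc
      have h := (Finset.mem_sdiff.1 ((hd4 z hz).2 x hzx).1).2
      rw [Finset.mem_union, not_or] at h
      exact ⟨hinbase x hx h.1, houtbase x hx h.2⟩
  refine ⟨W, r, hXW, hr', hrX, by omega, fun x hx => ?_⟩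
  by_cases hxL : x ∈ L
  · refine ⟨?_, ?_⟩
    · obtain ⟨hk1, hk2⟩ := ha4 x hxL
      refine .step x (by simp [hx]) (φa x) hk1.ge (fun u hu => by simpa using (hk2 u hu).1)
        fun u hu => ?_
      have h := hk2 u hu
      have hru : r u = r x := by rw [hra u h.2.2.1, h.2.2.2, hrX x (hLX hxL), id]
      have := (hmain u (hd1 (hc1 (hb1 h.2.2.1))) fun h' => h.2.1 (hLX h')).1
      rwa [hru] at this
    · obtain ⟨hk1, hk2⟩ := hb4 x hxL
      refine .step x (by simp [hx]) (φb x) hk1.ge (fun u hu => by simpa using (hk2 u hu).1)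
        fun u hu => ?_
      have h := hk2 u hu
      have hru : r u = r x := by rw [hrb u h.2.2.1, h.2.2.2, hra x (ha1 (hLX hxL))]
      have := (hmain u (hd1 (hc1 h.2.2.1)) fun h' => h.2.1 (ha1 (hLX h'))).2
      rwa [hru] at this
  · exact hmain x hx hxL

/-- Every small set `X` containing the low-degree vertices `L` extends to a small set `W` that
retracts onto `X` in such a way that each vertex of `W` is good within its own fibre. -/
theorem exists_closure {G : Digr V} {EA EB L X : Finset V} {k M : ℕ}
    (hk : 1 ≤ k) (hLX : L ⊆ X) (hL : L.card ≤ 28 * k) (hX : X.card ≤ 186 * k ^ 2)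
    (hM : 242 * k ^ 2 * (k + 1) ^ 2 ≤ M)
    (hin : ∀ v, M ≤ (G.inNbr v).card) (hout : ∀ v, M ≤ (G.rev.inNbr v).card)
    (hinE : ∀ v, v ∉ L → M ≤ (G.inNbr v \ EA).card)
    (houtE : ∀ v, v ∉ L → M ≤ (G.rev.inNbr v \ EB).card)
    (hboth : (∀ v, v ∉ L → M ≤ (G.rev.inNbr v \ (EA ∪ EB)).card) ∨
      ∀ v, v ∉ L → M ≤ (G.inNbr v \ (EA ∪ EB)).card) :
    ∃ (W : Finset V) (r : V → V), X ⊆ W ∧ (∀ x ∈ W, r x ∈ X) ∧ (∀ x ∈ X, r x = x) ∧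
      W.card ≤ 242 * k ^ 2 * (k + 1) ^ 2 ∧
      ∀ x ∈ W, G.InGood EA (W.filter fun y => r y = r x) k x ∧
        G.rev.InGood EB (W.filter fun y => r y = r x) k x := by
  rcases hboth with h | h
  · exact exists_closure_aux hk hLX hL hX hM hin hout hinE h
  · obtain ⟨W, r, h1, h2, h3, h4, h5⟩ := exists_closure_aux (G := G.rev) hk hLX hL hX hM hout hin
      houtE fun v hv => by rw [Finset.union_comm]; exact h v hv
    exact ⟨W, r, h1, h2, h3, h4, fun x hx => (h5 x hx).symm⟩

end Digr

namespace Digr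

open scoped Classical

/-- Two self-maps of a finite set have a large common independent set. -/
theorem exists_independent_subset {ι : Type} (f g : ι → ι) (n : ℕ) (I : Finset ι)
    (hI : 5 * n ≤ I.card) :
    ∃ J ⊆ I, J.card = n ∧ ∀ i ∈ J, ∀ j ∈ J, i ≠ j → f i ≠ j ∧ g i ≠ j := by
  induction n generalizing I with
  | zero => exact ⟨∅, by simp, by simp, by simp⟩
  | succ n ih =>
    have hne : I.Nonempty := Finset.card_pos.1 (by omega)
    have hsum : ∀ h : ι → ι, ∑ j ∈ I, (I.filter fun i => h i = j).card ≤ I.card := by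
      intro h
      rw [← Finset.card_biUnion]
      · exact Finset.card_le_card (by intro z; simp)
      · intro a _ b _ hab
        exact Finset.disjoint_filter.2 fun z _ h1 h2 => hab (h1.symm.trans h2)
    obtain ⟨j, hj, hjle⟩ : ∃ j ∈ I,
        (I.filter fun i => f i = j).card + (I.filter fun i => g i = j).card ≤ 2 := by
      by_contra! hcon
      have := Finset.sum_lt_sum_of_nonempty hne hcon
      rw [Finset.sum_add_distrib, Finset.sum_const, smul_eq_mul] at this
      have := hsum f
      have := hsum g
      omega
    let R : Finset ι := {j, f j, g j} ∪ ((I.filter fun i => f i = j) ∪ I.filter fun i => g i = j)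
    have hR : R.card ≤ 5 := by
      have h1 := Finset.card_union_le (I.filter fun i => f i = j) (I.filter fun i => g i = j)
      have h2 := Finset.card_union_le ({j, f j, g j} : Finset ι)
        ((I.filter fun i => f i = j) ∪ I.filter fun i => g i = j)
      have h3 : ({j, f j, g j} : Finset ι).card ≤ 3 := Finset.card_le_three
      change ({j, f j, g j} ∪ _ : Finset ι).card ≤ 5
      omega
    obtain ⟨J, hJ, hJn, hJi⟩ := ih (I \ R) (by
      have := Finset.le_card_sdiff R I
      omega)
    have hJR : ∀ i ∈ J, i ≠ j ∧ i ≠ f j ∧ i ≠ g j ∧ f i ≠ j ∧ g i ≠ j := by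
      intro i hi
      have := Finset.mem_sdiff.1 (hJ hi)
      simp only [R, Finset.mem_union, Finset.mem_insert, Finset.mem_singleton,
        Finset.mem_filter] at this
      tauto
    refine ⟨insert j J, ?_, ?_, ?_⟩
    · exact Finset.insert_subset hj (hJ.trans Finset.sdiff_subset)
    · rw [Finset.card_insert_of_notMem fun h => (hJR j h).1 rfl, hJn]
    · intro a ha b hb hab
      rcases Finset.mem_insert.1 ha with rfl | ha' <;> rcases Finset.mem_insert.1 hb with rfl | hb'
      · exact absurd rfl hab
      · exact ⟨(hJR b hb').2.1.symm, (hJR b hb').2.2.1.symm⟩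
      · exact (hJR a ha').2.2.2
      · exact hJi a ha' b hb' hab

variable {V : Type} [Fintype V]

/-- Two disjoint sets of good vertices extend to a partition of all vertices into two such sets,
provided every vertex outside has enough neighbours and no edge outside goes from `EB` to `EA`. -/
theorem exists_good_partition {G : Digr V} {EA EB Y₁ Y₂ : Finset V} {k : ℕ}
    (hdisj : Disjoint Y₁ Y₂)
    (hY₁ : ∀ x ∈ Y₁, G.InGood EA Y₁ k x ∧ G.rev.InGood EB Y₁ k x)
    (hY₂ : ∀ x ∈ Y₂, G.InGood EA Y₂ k x ∧ G.rev.InGood EB Y₂ k x)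
    (hnot : ∀ v, v ∉ Y₁ → v ∉ Y₂ → v ∈ EA → v ∉ EB)
    (hA : ∀ v, v ∉ Y₁ → v ∉ Y₂ → v ∈ EA → 2 * k ≤ (G.inNbr v \ EA).card)
    (hB : ∀ v, v ∉ Y₁ → v ∉ Y₂ → v ∈ EB → 2 * k ≤ (G.rev.inNbr v \ EB).card)
    (hE : ∀ u v, u ∉ Y₁ → u ∉ Y₂ → v ∉ Y₁ → v ∉ Y₂ → u ∈ EB → v ∈ EA → ¬ G.Adj u v) :
    ∃ V₁ V₂ : Finset V, Y₁ ⊆ V₁ ∧ Y₂ ⊆ V₂ ∧ Disjoint V₁ V₂ ∧ V₁ ∪ V₂ = Finset.univ ∧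
      (∀ x ∈ V₁, G.InGood EA V₁ k x ∧ G.rev.InGood EB V₁ k x) ∧
      ∀ x ∈ V₂, G.InGood EA V₂ k x ∧ G.rev.InGood EB V₂ k x := by
  let P : V → Prop := fun v => v ∉ Y₁ ∧ v ∉ Y₂ ∧
    ((v ∈ EA ∧ k ≤ ((G.inNbr v \ EA) ∩ Y₁).card) ∨ (v ∈ EB ∧ k ≤ ((G.rev.inNbr v \ EB) ∩ Y₁).card))
  let V₁ : Finset V := Y₁ ∪ Finset.univ.filter P
  have hV₁ : ∀ v, v ∈ V₁ ↔ v ∈ Y₁ ∨ P v := fun v => by simp [V₁]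
  have hV₂ : ∀ v, v ∈ V₁ᶜ ↔ v ∉ Y₁ ∧ ¬ P v := fun v => by simp [hV₁]
  have hs₁ : Y₁ ⊆ V₁ := Finset.subset_union_left
  have hs₂ : Y₂ ⊆ V₁ᶜ := fun v hv =>
    (hV₂ v).2 ⟨Finset.disjoint_right.1 hdisj hv, fun h => h.2.1 hv⟩
  refine ⟨V₁, V₁ᶜ, hs₁, hs₂, disjoint_compl_right, Finset.union_compl _, fun v hv => ?_,
    fun v hv => ?_⟩
  · rcases (hV₁ v).1 hv with h | ⟨h1, h2, ⟨h3, h4⟩ | ⟨h3, h4⟩⟩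
    · exact ⟨(hY₁ v h).1.mono subset_rfl hs₁, (hY₁ v h).2.mono subset_rfl hs₁⟩
    · refine ⟨.step v hv _ h4 (fun u hu => ?_) fun u hu => ?_, .base v hv (hnot v h1 h2 h3)⟩
      · simp only [Finset.mem_inter, Finset.mem_sdiff, mem_inNbr] at hu
        exact hu.1.1
      · simp only [Finset.mem_inter, Finset.mem_sdiff, mem_inNbr] at hu
        exact .base u (hs₁ hu.2) hu.1.2
    · refine ⟨.base v hv fun h => hnot v h1 h2 h h3,
        .step v hv _ h4 (fun u hu => ?_) fun u hu => ?_⟩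
      · simp only [Finset.mem_inter, Finset.mem_sdiff, mem_inNbr] at hu
        exact hu.1.1
      · simp only [Finset.mem_inter, Finset.mem_sdiff, mem_inNbr] at hu
        exact .base u (hs₁ hu.2) hu.1.2
  · have hv' := (hV₂ v).1 hv
    by_cases hvY : v ∈ Y₂
    · exact ⟨(hY₂ v hvY).1.mono subset_rfl hs₂, (hY₂ v hvY).2.mono subset_rfl hs₂⟩
    have hP := hv'.2
    simp only [P, not_and, not_or, not_le] at hP
    have hP := hP hv'.1 hvY
    refine ⟨?_, ?_⟩
    · by_cases hvA : v ∈ EA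
      · have h1 := hA v hv'.1 hvY hvA
        have h2 := hP.1 hvA
        have h3 := Finset.card_sdiff_add_card_inter (G.inNbr v \ EA) Y₁
        refine .step v hv ((G.inNbr v \ EA) \ Y₁) (by omega) (fun u hu => ?_) fun u hu => ?_
        · simp only [Finset.mem_sdiff, mem_inNbr] at hu
          exact hu.1.1
        · simp only [Finset.mem_sdiff, mem_inNbr] at hu
          refine .base u ((hV₂ u).2 ⟨hu.2, ?_⟩) hu.1.2
          rintro ⟨h1, h2, ⟨h3, -⟩ | ⟨h3, -⟩⟩
          · exact hu.1.2 h3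
          · exact hE u v h1 h2 hv'.1 hvY h3 hvA hu.1.1
      · exact .base v hv hvA
    · by_cases hvB : v ∈ EB
      · have h1 := hB v hv'.1 hvY hvB
        have h2 := hP.2 hvB
        have h3 := Finset.card_sdiff_add_card_inter (G.rev.inNbr v \ EB) Y₁
        refine .step v hv ((G.rev.inNbr v \ EB) \ Y₁) (by omega) (fun u hu => ?_) fun u hu => ?_
        · simp only [Finset.mem_sdiff, mem_inNbr] at hu
          exact hu.1.1
        · simp only [Finset.mem_sdiff, mem_inNbr] at hu
          refine .base u ((hV₂ u).2 ⟨hu.2, ?_⟩) hu.1.2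
          rintro ⟨h1, h2, ⟨h3, -⟩ | ⟨h3, -⟩⟩
          · exact hE v u hv'.1 hvY h1 h2 hvB h3 hu.1.1
          · exact hu.1.2 h3
      · exact .base v hv hvB

/-- Every vertex reaches every other vertex after the deletion of fewer than `K` vertices. -/
def HighlyConn (G : Digr V) (K : ℕ) : Prop :=
  K + 1 ≤ Fintype.card V ∧
    ∀ S : Finset V, S.card < K → ∀ u, u ∉ S → ∀ v, v ∉ S → G.Reaches (↑S)ᶜ u v

theorem StronglyConnOn.highlyConn {G : Digr V} {K : ℕ} (h : G.StronglyConnOn Set.univ K) :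
    G.HighlyConn K := by
  refine ⟨by simpa [Set.ncard_univ] using h.1, fun S hS u hu v hv => ?_⟩
  by_cases huv : u = v
  · subst huv; exact .refl hu
  · rw [Set.compl_eq_univ_sdiff]
    refine h.2 u trivial v trivial huv S ?_ (by rwa [Set.ncard_coe_finset])
    rintro x hx
    refine ⟨trivial, ?_⟩
    rintro (rfl | rfl)
    · exact hu hx
    · exact hv hx

theorem HighlyConn.rev {G : Digr V} {K : ℕ} (h : G.HighlyConn K) : G.rev.HighlyConn K :=
  ⟨h.1, fun S hS u hu v hv => (h.2 S hS v hv u hu).rev⟩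

theorem HighlyConn.le_card_inNbr {G : Digr V} {K : ℕ} (h : G.HighlyConn K) (hG : G.Loopless)
    (v : V) : K ≤ (G.inNbr v).card := by
  by_contra! hcon
  have hv : v ∉ G.inNbr v := by simpa using hG v
  have h1 : (insert v (G.inNbr v)).card < Fintype.card V := by
    rw [Finset.card_insert_of_notMem hv]
    have := h.1
    omega
  obtain ⟨u, hu⟩ : ∃ u, u ∉ insert v (G.inNbr v) := by
    by_contra! hall
    rw [Finset.eq_univ_of_forall hall, Finset.card_univ] at h1
    exact lt_irrefl _ h1
  rw [Finset.mem_insert, not_or] at hu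
  obtain ⟨-, hr⟩ := reaches_iff.1 (h.2 _ hcon u hu.2 v hv)
  rcases Relation.ReflTransGen.cases_tail hr with h2 | ⟨w, h2, h3⟩
  · exact hu.1 h2.symm
  · rcases Relation.ReflTransGen.cases_tail h2 with h4 | ⟨z, -, h5⟩
    · subst h4; exact hu.2 (by simpa using h3.1)
    · exact h5.2 (by simpa using h3.1)

end Digr

namespace Digr

open scoped Classical

variable {V : Type} [Fintype V]

/-- Disjoint small transitive sets `A s` with source `s ∈ S` and `B t` with sink `t ∈ T` that
almost dominate the digraph, `L` being a small set of exceptional vertices. -/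
structure Frame (G : Digr V) (k M : ℕ) (v₁ v₂ : V) where
  L : Finset V
  S : Finset V
  T : Finset V
  A : V → Finset V
  B : V → Finset V
  card_L : L.card ≤ 28 * k
  card_S : S.card = 13 * k
  card_T : T.card = 13 * k
  card_A : ∀ s ∈ S, (A s).card ≤ k + 6
  card_B : ∀ t ∈ T, (B t).card ≤ k + 6
  isSource : ∀ s ∈ S, G.IsSource (A s) s
  isSink : ∀ t ∈ T, G.rev.IsSource (B t) t
  disjoint_A : ∀ s ∈ S, ∀ s' ∈ S, s ≠ s' → Disjoint (A s) (A s')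
  disjoint_B : ∀ t ∈ T, ∀ t' ∈ T, t ≠ t' → Disjoint (B t) (B t')
  disjoint_AB : ∀ s ∈ S, ∀ t ∈ T, Disjoint (A s) (B t)
  notMem_A : ∀ s ∈ S, v₁ ∉ A s ∧ v₂ ∉ A s
  notMem_B : ∀ t ∈ T, v₁ ∉ B t ∧ v₂ ∉ B t
  L_subset : L ⊆ {v₁, v₂} ∪ (S.biUnion A ∪ T.biUnion B)
  le_in : ∀ v, v ∉ L → M ≤ (G.inNbr v \ S.biUnion fun s => G.undom (A s)).card
  le_out : ∀ v, v ∉ L → M ≤ (G.rev.inNbr v \ T.biUnion fun t => G.rev.undom (B t)).card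
  le_both : (∀ v, v ∉ L → M ≤ (G.rev.inNbr v \ ((S.biUnion fun s => G.undom (A s)) ∪
      T.biUnion fun t => G.rev.undom (B t))).card) ∨
    ∀ v, v ∉ L → M ≤ (G.inNbr v \ ((S.biUnion fun s => G.undom (A s)) ∪
      T.biUnion fun t => G.rev.undom (B t))).card

theorem card_undom_biUnion_le {G : Digr V} {S X : Finset V} {A : V → Finset V} {k D : ℕ}
    (hk : 1 ≤ k) (hS : S.card = 13 * k)
    (h : ∀ s ∈ S, 2 ^ (k + 5) * (G.undom (A s) \ X).card ≤ D) :
    4 * ((S.biUnion fun s => G.undom (A s)) \ X).card ≤ D := by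
  have h1 : ((S.biUnion fun s => G.undom (A s)) \ X).card
      ≤ ∑ s ∈ S, (G.undom (A s) \ X).card := by
    refine (Finset.card_le_card (t := S.biUnion fun s => G.undom (A s) \ X) fun z => ?_).trans
      Finset.card_biUnion_le
    simp only [Finset.mem_sdiff, Finset.mem_biUnion]
    tauto
  have h2k : 52 * k ≤ 2 ^ (k + 5) := by
    have := Nat.lt_two_pow_self (n := k - 1)
    obtain ⟨j, rfl⟩ : ∃ j, k = j + 1 := ⟨k - 1, by omega⟩
    rw [show j + 1 + 5 = j + 6 from rfl, pow_add]
    simp only [Nat.add_sub_cancel] at this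
    omega
  have h2 : ∑ s ∈ S, 52 * k * (G.undom (A s) \ X).card ≤ S.card * D := by
    rw [← smul_eq_mul (S.card)]
    refine Finset.sum_le_card_nsmul _ _ _ fun s hs => ?_
    exact (Nat.mul_le_mul_right _ h2k).trans (h s hs)
  rw [← Finset.mul_sum, hS] at h2
  have h3 : 13 * k * (4 * ∑ s ∈ S, (G.undom (A s) \ X).card) ≤ 13 * k * D := by
    calc _ = 52 * k * ∑ s ∈ S, (G.undom (A s) \ X).card := by ring
      _ ≤ _ := h2
  have := Nat.le_of_mul_le_mul_left h3 (by omega)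
  omega

theorem IsTournament.exists_frame {G : Digr V} (hG : G.IsTournament) {k M : ℕ} (hk : 1 ≤ k)
    (hM : 184 * k ^ 2 ≤ M) (hconn : G.HighlyConn (4 * M)) (v₁ v₂ : V) :
    Nonempty (Frame G k M v₁ v₂) := by
  have hkM : 184 * k ≤ M := le_trans (by nlinarith) hM
  have hn := hconn.1
  have hv : ({v₁, v₂} : Finset V).card ≤ 2 := Finset.card_le_two
  obtain ⟨C, D, hC1, hC2, hC3, hC4, hC5⟩ := exists_lowest (fun v => (G.inNbr v).card) {v₁, v₂}
    (13 * k) (by omega)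
  have hCv := Finset.card_union_le {v₁, v₂} C
  obtain ⟨C', D', hD1, hD2, hD3, hD4, hD5⟩ := exists_lowest (fun v => (G.rev.inNbr v).card)
    ({v₁, v₂} ∪ C) (13 * k) (by omega)
  rw [Finset.disjoint_union_right] at hD1
  have hD : 4 * M ≤ D := by
    rcases hC5 with h | ⟨x, -, rfl⟩
    · omega
    · exact hconn.le_card_inNbr hG.1 x
  have hD' : 4 * M ≤ D' := by
    rcases hD5 with h | ⟨x, -, rfl⟩
    · omega
    · exact hconn.rev.le_card_inNbr hG.1 x
  obtain ⟨S, A, hS1, hS2, hS3, hS4, hS5, hS6, hS7⟩ := hG.exists_dominating_family (k + 5) D C hC3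
    ({v₁, v₂} ∪ C') (by rw [Finset.disjoint_union_right]; exact ⟨hC1, hD1.2.symm⟩)
  obtain ⟨T, B, hT1, hT2, hT3, hT4, hT5, hT6, hT7⟩ := hG.rev.exists_dominating_family (k + 5) D' C'
    hD3 ({v₁, v₂} ∪ S.biUnion A) (by
      rw [Finset.disjoint_union_right, Finset.disjoint_biUnion_right]
      refine ⟨hD1.1, fun s hs => ?_⟩
      have := hS6 s hs
      rw [Finset.disjoint_union_right] at this
      exact this.2.symm)
  rw [hC2] at hS1
  rw [hD2] at hT1
  let X : Finset V := {v₁, v₂} ∪ (S.biUnion A ∪ T.biUnion B)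
  have hXA : {v₁, v₂} ∪ C' ∪ S.biUnion A ⊆ X := by
    intro z
    have := @hT2 z
    simp only [X, Finset.mem_union]
    tauto
  have hXB : {v₁, v₂} ∪ S.biUnion A ∪ T.biUnion B ⊆ X := by
    rw [Finset.union_assoc]
  have hXc : X.card ≤ 184 * k ^ 2 := by
    have h1 : (S.biUnion A).card ≤ 13 * k * (k + 5 + 1) := by
      rw [← hS1]; exact Finset.card_biUnion_le_card_mul _ _ _ hS4
    have h2 : (T.biUnion B).card ≤ 13 * k * (k + 5 + 1) := by
      rw [← hT1]; exact Finset.card_biUnion_le_card_mul _ _ _ hT4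
    have h3 := Finset.card_union_le {v₁, v₂} (S.biUnion A ∪ T.biUnion B)
    have h4 := Finset.card_union_le (S.biUnion A) (T.biUnion B)
    have h5 : X.card ≤ 2 + (13 * k * (k + 5 + 1) + 13 * k * (k + 5 + 1)) := by
      simp only [X]; omega
    nlinarith
  obtain ⟨EA, hEAdef⟩ : ∃ EA, EA = S.biUnion fun s => G.undom (A s) := ⟨_, rfl⟩
  obtain ⟨EB, hEBdef⟩ : ∃ EB, EB = T.biUnion fun t => G.rev.undom (B t) := ⟨_, rfl⟩
  have hEA : 4 * (EA \ X).card ≤ D := by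
    rw [hEAdef]
    refine card_undom_biUnion_le hk hS1 fun s hs => le_trans (Nat.mul_le_mul_left _ ?_) (hS7 s hs)
    exact Finset.card_le_card (Finset.sdiff_subset_sdiff subset_rfl hXA)
  have hEB : 4 * (EB \ X).card ≤ D' := by
    rw [hEBdef]
    refine card_undom_biUnion_le hk hT1 fun s hs => le_trans (Nat.mul_le_mul_left _ ?_) (hT7 s hs)
    exact Finset.card_le_card (Finset.sdiff_subset_sdiff subset_rfl hXB)
  clear_value X
  have hN : ∀ N E : Finset V, N.card ≤ (N \ E).card + (E \ X).card + X.card := by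
    intro N E
    have h1 : N ⊆ ((N \ E) ∪ (E \ X)) ∪ X := by intro z; simp; tauto
    have h2 := Finset.card_le_card h1
    have h3 := Finset.card_union_le ((N \ E) ∪ (E \ X)) X
    have h4 := Finset.card_union_le (N \ E) (E \ X)
    omega
  have hboth : ((EA ∪ EB) \ X).card ≤ (EA \ X).card + (EB \ X).card := by
    rw [Finset.union_sdiff_distrib]
    exact Finset.card_union_le _ _
  let L : Finset V := {v₁, v₂} ∪ C ∪ C'
  have hin : ∀ v, v ∉ L → D ≤ (G.inNbr v).card := fun v hv => by
    simp only [L, Finset.mem_union, not_or] at hv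
    exact hC4 v hv.1.2 hv.1.1
  have hout : ∀ v, v ∉ L → D' ≤ (G.rev.inNbr v).card := fun v hv => by
    simp only [L, Finset.mem_union, not_or] at hv
    exact hD4 v hv.2 (by simpa only [Finset.mem_union, not_or] using hv.1)
  refine ⟨⟨L, S, T, A, B, ?_, hS1, hT1, hS4, hT4, hS3, hT3, hS5, hT5, fun s hs t ht => ?_,
    fun s hs => ?_, fun t ht => ?_, fun z => ?_, fun v hv => ?_, fun v hv => ?_, ?_⟩⟩
  · have := Finset.card_union_le ({v₁, v₂} ∪ C) C'
    simp only [L]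
    omega
  · have := hT6 t ht
    rw [Finset.disjoint_union_right, Finset.disjoint_biUnion_right] at this
    exact (this.2 s hs).symm
  · have := Finset.disjoint_right.1 (hS6 s hs)
    exact ⟨this (by simp), this (by simp)⟩
  · have := Finset.disjoint_right.1 (hT6 t ht)
    exact ⟨this (by simp), this (by simp)⟩
  · simp only [L, Finset.mem_union]
    exact fun h => h.elim (fun h => h.imp_right fun h => .inl (hS2 h)) fun h => .inr (.inr (hT2 h))
  · have h1 := hN (G.inNbr v) EA
    have h2 := hin v hv
    rw [← hEAdef]
    omega
  · have h1 := hN (G.rev.inNbr v) EB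
    have h2 := hout v hv
    rw [← hEBdef]
    omega
  · rw [← hEAdef, ← hEBdef]
    rcases le_total D D' with hDD | hDD
    · refine .inl fun v hv => ?_
      have h1 := hN (G.rev.inNbr v) (EA ∪ EB)
      have h2 := hout v hv
      omega
    · refine .inr fun v hv => ?_
      have h1 := hN (G.inNbr v) (EA ∪ EB)
      have h2 := hin v hv
      omega

end Digr

namespace Digr

open scoped Classical

variable {V : Type}

/-- A family of triples `(t, s, Z)` such that `s ∈ S` can be reached from `t ∈ T` through at most
two intermediate vertices `Z` outside `X`; distinct triples are disjoint. -/
def IsShortFamily (G : Digr V) (T S X : Finset V) (H : Finset (V × V × Finset V)) : Prop :=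
  (∀ q ∈ H, q.1 ∈ T ∧ q.2.1 ∈ S ∧ q.2.2.card ≤ 2 ∧ Disjoint q.2.2 X ∧
    G.Reaches ↑({q.1, q.2.1} ∪ q.2.2) q.1 q.2.1) ∧
  ∀ q ∈ H, ∀ q' ∈ H, q ≠ q' → q.1 ≠ q'.1 ∧ q.2.1 ≠ q'.2.1 ∧ Disjoint q.2.2 q'.2.2

theorem exists_isShortFamily (G : Digr V) (T S X : Finset V) (k : ℕ) :
    ∃ H, G.IsShortFamily T S X H ∧ H.card ≤ k ∧ (H.card = k ∨
      ∀ t ∈ T \ H.image (fun q => q.1), ∀ s ∈ S \ H.image (fun q => q.2.1), ∀ Z : Finset V,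
        Z.card ≤ 2 → Disjoint Z (X ∪ H.biUnion fun q => q.2.2) → ¬ G.Reaches ↑({t, s} ∪ Z) t s) := by
  induction k with
  | zero => exact ⟨∅, by simp [IsShortFamily]⟩
  | succ k ih =>
    obtain ⟨H, hH, hHk, hmax⟩ := ih
    by_cases hex : ∀ t ∈ T \ H.image (fun q => q.1), ∀ s ∈ S \ H.image (fun q => q.2.1),
        ∀ Z : Finset V, Z.card ≤ 2 → Disjoint Z (X ∪ H.biUnion fun q => q.2.2) →
          ¬ G.Reaches ↑({t, s} ∪ Z) t s
    · exact ⟨H, hH, by omega, .inr hex⟩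
    have hHk' : H.card = k := hmax.resolve_right hex
    push Not at hex
    obtain ⟨t, ht, s, hs, Z, hZ, hZX, hr⟩ := hex
    simp only [Finset.mem_sdiff, Finset.mem_image, not_exists, not_and] at ht hs
    rw [Finset.disjoint_union_right, Finset.disjoint_biUnion_right] at hZX
    have hnot : (t, s, Z) ∉ H := fun h => ht.2 _ h rfl
    have hc : (insert (t, s, Z) H).card = k + 1 := by
      rw [Finset.card_insert_of_notMem hnot, hHk']
    refine ⟨insert (t, s, Z) H, ⟨?_, ?_⟩, hc.le, .inl hc⟩
    · intro q hq
      rcases Finset.mem_insert.1 hq with rfl | hq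
      · exact ⟨ht.1, hs.1, hZ, hZX.1, hr⟩
      · exact hH.1 q hq
    · intro q hq q' hq' hne
      rcases Finset.mem_insert.1 hq with rfl | hq1 <;> rcases Finset.mem_insert.1 hq' with rfl | hq2
      · exact absurd rfl hne
      · exact ⟨fun h => ht.2 q' hq2 h.symm, fun h => hs.2 q' hq2 h.symm, hZX.2 q' hq2⟩
      · exact ⟨ht.2 q hq1, hs.2 q hq1, (hZX.2 q hq1).symm⟩
      · exact hH.2 q hq1 q' hq2 hne

variable [Fintype V]

theorem HighlyConn.stronglyConnOn_compl {G : Digr V} {K k : ℕ} (h : G.HighlyConn K) {U : Finset V}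
    (hU : U.card + k ≤ K) : G.StronglyConnOn ↑(Uᶜ) k := by
  refine ⟨?_, fun u hu v hv _ S hS hSk => ?_⟩
  · rw [Set.ncard_coe_finset, Finset.card_compl]
    have := h.1
    omega
  · have hfin : S.Finite := Set.toFinite S
    have hc : (U ∪ hfin.toFinset).card < K := by
      have := Finset.card_union_le U hfin.toFinset
      rw [Set.ncard_eq_toFinset_card S hfin] at hSk
      omega
    have hmem : ∀ w, w ∈ ({u, v} : Set V) → w ∈ (↑(Uᶜ) : Set V) → w ∉ U ∪ hfin.toFinset := by
      intro w hw hwU hw'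
      rcases Finset.mem_union.1 hw' with h | h
      · simp only [Finset.coe_compl, Set.mem_compl_iff, Finset.mem_coe] at hwU
        exact hwU h
      · exact (hS (hfin.mem_toFinset.1 h)).2 hw
    refine (h.2 _ hc u (hmem u (by simp) hu) v (hmem v (by simp) hv)).mono ?_
    intro z hz
    simpa [not_or] using hz

namespace Frame

variable {G : Digr V} {k M : ℕ} {v₁ v₂ : V}

/-- The vertices covered by the frame. -/
noncomputable def X (F : Frame G k M v₁ v₂) : Finset V :=
  {v₁, v₂} ∪ (F.S.biUnion F.A ∪ F.T.biUnion F.B)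

/-- The vertices not dominated by some set `A s` with `s ∈ S'`. -/
noncomputable def EA (F : Frame G k M v₁ v₂) (S' : Finset V) : Finset V :=
  S'.biUnion fun s => G.undom (F.A s)

/-- The vertices not dominating some set `B t` with `t ∈ T'`. -/
noncomputable def EB (F : Frame G k M v₁ v₂) (T' : Finset V) : Finset V :=
  T'.biUnion fun t => G.rev.undom (F.B t)

theorem card_X_le (F : Frame G k M v₁ v₂) (hk : 1 ≤ k) : F.X.card ≤ 184 * k ^ 2 := by
  have h1 : (F.S.biUnion F.A).card ≤ 13 * k * (k + 6) := by
    rw [← F.card_S]; exact Finset.card_biUnion_le_card_mul _ _ _ F.card_A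
  have h2 : (F.T.biUnion F.B).card ≤ 13 * k * (k + 6) := by
    rw [← F.card_T]; exact Finset.card_biUnion_le_card_mul _ _ _ F.card_B
  have h3 := Finset.card_union_le {v₁, v₂} (F.S.biUnion F.A ∪ F.T.biUnion F.B)
  have h4 := Finset.card_union_le (F.S.biUnion F.A) (F.T.biUnion F.B)
  have h5 : ({v₁, v₂} : Finset V).card ≤ 2 := Finset.card_le_two
  have h6 : F.X.card ≤ 2 + (13 * k * (k + 6) + 13 * k * (k + 6)) := by
    rw [X]; omega
  nlinarith

theorem A_subset_X (F : Frame G k M v₁ v₂) {s : V} (hs : s ∈ F.S) : F.A s ⊆ F.X := by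
  intro z hz
  simp only [X, Finset.mem_union, Finset.mem_biUnion]
  exact .inr (.inl ⟨s, hs, hz⟩)

theorem B_subset_X (F : Frame G k M v₁ v₂) {t : V} (ht : t ∈ F.T) : F.B t ⊆ F.X := by
  intro z hz
  simp only [X, Finset.mem_union, Finset.mem_biUnion]
  exact .inr (.inr ⟨t, ht, hz⟩)

theorem left_mem_X (F : Frame G k M v₁ v₂) : v₁ ∈ F.X := by simp [X]

theorem right_mem_X (F : Frame G k M v₁ v₂) : v₂ ∈ F.X := by simp [X]

theorem ne_of_mem (F : Frame G k M v₁ v₂) {s t : V} (hs : s ∈ F.S) (ht : t ∈ F.T) : t ≠ s := by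
  rintro rfl
  exact Finset.disjoint_left.1 (F.disjoint_AB t hs t ht) (F.isSource t hs).1 (F.isSink t ht).1

/-- A set of good vertices containing `k` disjoint paths from `T'` to `S'`, together with the sets
of the frame at their ends, is strongly `k`-connected. -/
theorem stronglyConnOn (F : Frame G k M v₁ v₂) (hG : G.IsTournament) (hk : 1 ≤ k)
    {S' T' U : Finset V} (hS' : S' ⊆ F.S) (hT' : T' ⊆ F.T) {ι : Type} {I : Finset ι}
    (hI : k ≤ I.card) (t s : ι → V) (Z : ι → Finset V)
    (ht : ∀ i ∈ I, t i ∈ T') (hs : ∀ i ∈ I, s i ∈ S')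
    (hne : ∀ i ∈ I, ∀ j ∈ I, i ≠ j → t i ≠ t j ∧ s i ≠ s j ∧ Disjoint (Z i) (Z j))
    (hZ : ∀ i ∈ I, Disjoint (Z i) F.X)
    (hU : ∀ i ∈ I, F.B (t i) ∪ Z i ∪ F.A (s i) ⊆ U)
    (hr : ∀ i ∈ I, G.Reaches ↑({t i, s i} ∪ Z i) (t i) (s i))
    (hgood : ∀ v ∈ U, G.InGood (F.EA S') U k v ∧ G.rev.InGood (F.EB T') U k v) :
    G.StronglyConnOn U k := by
  refine stronglyConnOn_of_cores (EA := F.EA S') (EB := F.EB T') hk hI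
    (fun i => F.B (t i) ∪ Z i ∪ F.A (s i)) t s ?_ hU
    (fun i hi => F.ne_of_mem (hS' (hs i hi)) (hT' (ht i hi))) (fun i hi => (hr i hi).mono ?_)
    (fun i hi v hv hvE => ?_) (fun i hi v hv hvE => ?_) (fun v hv => (hgood v hv).1)
    fun v hv => (hgood v hv).2
  · intro i hi j hj hij
    obtain ⟨h1, h2, h3⟩ := hne i hi j hj hij
    have hA : ∀ i ∈ I, ∀ j ∈ I, Disjoint (Z i) (F.A (s j)) := fun i hi j hj =>
      (hZ i hi).mono_right (F.A_subset_X (hS' (hs j hj)))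
    have hB : ∀ i ∈ I, ∀ j ∈ I, Disjoint (Z i) (F.B (t j)) := fun i hi j hj =>
      (hZ i hi).mono_right (F.B_subset_X (hT' (ht j hj)))
    have hAB : ∀ i ∈ I, ∀ j ∈ I, Disjoint (F.A (s i)) (F.B (t j)) := fun i hi j hj =>
      F.disjoint_AB _ (hS' (hs i hi)) _ (hT' (ht j hj))
    simp only [Finset.disjoint_union_left, Finset.disjoint_union_right]
    exact ⟨⟨⟨⟨F.disjoint_B _ (hT' (ht i hi)) _ (hT' (ht j hj)) h1, hB i hi j hj⟩, hAB i hi j hj⟩,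
      ⟨(hB j hj i hi).symm, h3⟩, (hA j hj i hi).symm⟩, ⟨(hAB j hj i hi).symm, hA i hi j hj⟩,
      F.disjoint_A _ (hS' (hs i hi)) _ (hS' (hs j hj)) h2⟩
  · intro z hz
    have h1 := (F.isSource _ (hS' (hs i hi))).1
    have h2 := (F.isSink _ (hT' (ht i hi))).1
    simp only [Finset.coe_union, Finset.coe_insert, Finset.coe_singleton, Set.mem_union,
      Set.mem_insert_iff, Set.mem_singleton_iff, Finset.mem_coe] at hz ⊢
    rcases hz with (rfl | rfl) | h
    · exact .inl (.inl h2)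
    · exact .inr h1
    · exact .inl (.inr h)
  · have hv' : v ∉ G.undom (F.A (s i)) := fun h =>
      hvE (Finset.mem_biUnion.2 ⟨_, hs i hi, h⟩)
    refine ((F.isSource _ (hS' (hs i hi))).reaches hG hv').mono ?_
    exact Finset.coe_subset.2 (Finset.insert_subset_insert _ Finset.subset_union_right)
  · have hv' : v ∉ G.rev.undom (F.B (t i)) := fun h =>
      hvE (Finset.mem_biUnion.2 ⟨_, ht i hi, h⟩)
    refine ((F.isSink _ (hT' (ht i hi))).reaches hG.rev hv').rev.mono ?_
    refine Finset.coe_subset.2 (Finset.insert_subset_insert _ ?_)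
    rw [Finset.union_assoc]
    exact Finset.subset_union_left

/-- The partition theorem when there are `k` disjoint short connections. -/
theorem exists_partition_of_short (F : Frame G k M v₁ v₂) (hG : G.IsTournament) (hk : 1 ≤ k)
    (hv : v₁ ≠ v₂) {K : ℕ} (hconn : G.HighlyConn K) {H : Finset (V × V × Finset V)}
    (hH : G.IsShortFamily F.T F.S F.X H) (hHk : H.card = k) {W : Finset V} {r : V → V}
    (hXW : F.X ∪ H.biUnion (fun q => q.2.2) ⊆ W)
    (hr : ∀ x ∈ F.X ∪ H.biUnion (fun q => q.2.2), r x = x) (hW : W.card + k ≤ K)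
    (hgood : ∀ x ∈ W, G.InGood (F.EA F.S) (W.filter fun y => r y = r x) k x ∧
      G.rev.InGood (F.EB F.T) (W.filter fun y => r y = r x) k x) :
    ∃ U : Finset V, v₁ ∈ U ∧ v₂ ∉ U ∧ G.StronglyConnOn U k ∧ G.StronglyConnOn ↑(Uᶜ) k := by
  let P : Finset V := insert v₁ (H.biUnion fun q => F.B q.1 ∪ q.2.2 ∪ F.A q.2.1)
  have hPX : P ⊆ F.X ∪ H.biUnion (fun q => q.2.2) := by
    refine Finset.insert_subset (Finset.mem_union_left _ F.left_mem_X)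
      (Finset.biUnion_subset.2 fun q hq => Finset.union_subset (Finset.union_subset ?_ ?_) ?_)
    · exact (F.B_subset_X (hH.1 q hq).1).trans Finset.subset_union_left
    · exact (Finset.subset_biUnion_of_mem (fun q : V × V × Finset V => q.2.2) hq).trans
        Finset.subset_union_right
    · exact (F.A_subset_X (hH.1 q hq).2.1).trans Finset.subset_union_left
  let U : Finset V := W.filter fun x => r x ∈ P
  have hPU : P ⊆ U := fun x hx =>
    Finset.mem_filter.2 ⟨hXW (hPX hx), by rwa [hr x (hPX hx)]⟩
  have hfib : ∀ x ∈ U, (W.filter fun y => r y = r x) ⊆ U := by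
    intro x hx y hy
    rw [Finset.mem_filter] at hx hy ⊢
    exact ⟨hy.1, by rw [hy.2]; exact hx.2⟩
  refine ⟨U, hPU (Finset.mem_insert_self _ _), ?_, ?_, hconn.stronglyConnOn_compl ?_⟩
  · intro h
    have h := (Finset.mem_filter.1 h).2
    rw [hr _ (Finset.mem_union_left _ F.right_mem_X)] at h
    rcases Finset.mem_insert.1 h with h | h
    · exact hv h.symm
    · obtain ⟨q, hq, h⟩ := Finset.mem_biUnion.1 h
      obtain ⟨h1, h2, -, h3, -⟩ := hH.1 q hq
      rcases Finset.mem_union.1 h with h | h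
      · rcases Finset.mem_union.1 h with h | h
        · exact (F.notMem_B _ h1).2 h
        · exact Finset.disjoint_left.1 h3 h F.right_mem_X
      · exact (F.notMem_A _ h2).2 h
  · refine F.stronglyConnOn hG hk subset_rfl subset_rfl hHk.ge (fun q => q.1) (fun q => q.2.1)
      (fun q => q.2.2) (fun q hq => (hH.1 q hq).1) (fun q hq => (hH.1 q hq).2.1) hH.2
      (fun q hq => (hH.1 q hq).2.2.2.1) (fun q hq => ?_) (fun q hq => (hH.1 q hq).2.2.2.2)
      fun x hx => ?_
    · refine Finset.Subset.trans ?_ hPU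
      exact (Finset.subset_biUnion_of_mem
        (fun q : V × V × Finset V => F.B q.1 ∪ q.2.2 ∪ F.A q.2.1) hq).trans (Finset.subset_insert _ _)
    · have := hgood x (Finset.mem_filter.1 hx).1
      exact ⟨this.1.mono subset_rfl (hfib x hx), this.2.mono subset_rfl (hfib x hx)⟩
  · have := Finset.card_le_card (Finset.filter_subset (fun x => r x ∈ P) W)
    change (W.filter fun x => r x ∈ P).card + k ≤ K
    omega

end Frame

end Digr

namespace Digr

open scoped Classical

variable {V : Type}

/-- The linkage condition of `exists_minimal_linkage`. -/
def IsMinimalLinkage (G : Digr V) (Y P Q : Finset V) {p : ℕ} (L : Fin p → List V) : Prop :=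
  G.IsLinkage Y P Q L ∧ ∀ i, ∀ x ∈ P, ∀ y ∈ Q, ∀ l, G.IsPathOn Y x y l →
    (∀ j, j ≠ i → l.Disjoint (L j)) → (L i).length ≤ l.length

theorem IsMinimalLinkage.rev {G : Digr V} {Y P Q : Finset V} {p : ℕ} {L : Fin p → List V}
    (h : G.IsMinimalLinkage Y P Q L) :
    G.rev.IsMinimalLinkage Y Q P fun i => (L i).reverse := by
  refine ⟨⟨fun i => ?_, fun i j hij => ?_⟩, fun i x hx y hy l hl hdis => ?_⟩
  · obtain ⟨x, hx, y, hy, hp⟩ := h.1.1 i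
    exact ⟨y, hy, x, hx, hp.rev⟩
  · intro z hz hz'
    exact h.1.2 i j hij (by simpa using hz) (by simpa using hz')
  · have := h.2 i y hy x hx l.reverse hl.rev fun j hj z hz hz' =>
      hdis j hj (by simpa using hz) (by simpa using hz')
    simpa using this

theorem IsMinimalLinkage.eq_of_mem {G : Digr V} {Y P Q : Finset V} {p : ℕ} {L : Fin p → List V}
    (h : G.IsMinimalLinkage Y P Q L) {i : Fin p} {x y : V} (hy : y ∈ Q)
    (hp : G.IsPathOn Y x y (L i)) {v : V} (hv : v ∈ L i) (hvP : v ∈ P) : v = x := by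
  obtain ⟨l₁, l₂, hl⟩ := List.append_of_mem hv
  obtain ⟨h1, h2, h3, h4, h5⟩ := hp
  rw [hl] at h1 h2 h4 h5
  have hp' : G.IsPathOn Y v y (v :: l₂) :=
    ⟨(List.nodup_append.1 h1).2.1, (List.isChain_append.1 h2).2.1,
      fun z hz => h3 z (by rw [hl]; exact List.mem_append_right _ hz), by simp, by simpa using h5⟩
  have hlen := h.2 i v hvP y hy _ hp' fun j hj z hz =>
    h.1.2 i j hj.symm (by rw [hl]; exact List.mem_append_right _ hz)
  rw [hl, List.length_append] at hlen
  obtain rfl : l₁ = [] := List.eq_nil_of_length_eq_zero (by omega)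
  simpa using h4

theorem IsMinimalLinkage.exists_second {G : Digr V} {Y P Q : Finset V} {p : ℕ}
    {L : Fin p → List V} (h : G.IsMinimalLinkage Y P Q L) (hPY : P ⊆ Y) {i : Fin p} {x y : V}
    (hx : x ∈ P) (hy : y ∈ Q) (hp : G.IsPathOn Y x y (L i)) (hPQ : Disjoint P Q)
    (hno : ∀ x ∈ P, ∀ y ∈ Q, ¬ G.Adj x y) :
    ∃ u ∈ L i, G.Adj x u ∧ u ≠ x ∧ u ≠ y ∧ ∀ v ∈ L i, v ≠ x → v ≠ u →
      ∀ q ∈ P, (∀ j, q ∉ L j) → ¬ G.Adj q v := by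
  obtain ⟨h1, h2, h3, h4, h5⟩ := hp
  obtain ⟨l, hl⟩ : ∃ l, L i = l := ⟨_, rfl⟩
  rw [hl] at h1 h2 h3 h4 h5
  match l with
  | [] => simp at h4
  | [a] =>
    obtain rfl : a = x := by simpa using h4
    obtain rfl : a = y := by simpa using h5
    exact absurd hy (Finset.disjoint_left.1 hPQ hx)
  | a :: u :: l =>
    obtain rfl : a = x := by simpa using h4
    have hau := (List.isChain_cons_cons.1 h2).1
    refine ⟨u, by simp [hl], hau, ?_, ?_, fun v hv hva hvu q hq hqL hqv => ?_⟩
    · rintro rfl; simp at h1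
    · rintro rfl; exact hno _ hx _ hy hau
    · rw [hl] at hv
      have hv : v ∈ l := by
        simp only [List.mem_cons] at hv
        tauto
      obtain ⟨l₁, l₂, rfl⟩ := List.append_of_mem hv
      have hsub : ∀ z ∈ v :: l₂, z ∈ L i := fun z hz => by
        rw [hl]; exact List.mem_cons_of_mem _ (List.mem_cons_of_mem _ (List.mem_append_right _ hz))
      have hsplit : a :: u :: (l₁ ++ v :: l₂) = (a :: u :: l₁) ++ v :: l₂ := by simp
      rw [hsplit] at h1 h2 h5
      rw [List.getLast?_append_of_ne_nil _ (by simp)] at h5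
      have hlen := h.2 i q hq y hy (q :: v :: l₂) ⟨List.nodup_cons.2
        ⟨fun hz => hqL i (hsub q hz), (List.nodup_append.1 h1).2.1⟩,
        List.isChain_cons_cons.2 ⟨hqv, (List.isChain_append.1 h2).2.1⟩, fun z hz => ?_, by simp,
        by simpa using h5⟩ fun j hj z hz hz' => ?_
      · rw [hl] at hlen
        simp at hlen
        omega
      · rcases List.mem_cons.1 hz with rfl | hz
        · exact hPY hq
        · have := hsub z hz
          rw [hl] at this
          exact h3 z this
      · rcases List.mem_cons.1 hz with rfl | hz
        · exact hqL j hz'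
        · exact h.1.2 i j hj.symm (hsub z hz) hz'

/-- Disjoint paths from `P` to `Q` whose interiors `R i` avoid `W`, such that the vertices of `P`
and `Q` that are not used are joined to nearly all interior vertices in a prescribed direction. -/
theorem IsTournament.exists_directed_linkage [Fintype V] {G : Digr V} (hG : G.IsTournament)
    {P Q W : Finset V} {p : ℕ} (hP : P ⊆ W) (hQ : Q ⊆ W) (hPQ : Disjoint P Q)
    (hno : ∀ x ∈ P, ∀ y ∈ Q, ¬ G.Adj x y)
    (hsep : ∀ S : Finset V, S.card < p →
      ∃ x ∈ P \ S, ∃ y ∈ Q \ S, G.Reaches (↑(Wᶜ ∪ P ∪ Q) \ ↑S) x y) :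
    ∃ (t u d s : Fin p → V) (R : Fin p → Finset V),
      (∀ i, t i ∈ P) ∧ (∀ i, s i ∈ Q) ∧
      (∀ i j, i ≠ j → t i ≠ t j ∧ s i ≠ s j ∧ Disjoint (R i) (R j)) ∧
      (∀ i, Disjoint (R i) W) ∧ (∀ i, u i ∈ R i) ∧ (∀ i, d i ∈ R i) ∧
      (∀ i, G.Adj (t i) (u i)) ∧ (∀ i, G.Adj (d i) (s i)) ∧
      (∀ i, G.Reaches ↑({t i, s i} ∪ R i) (t i) (s i)) ∧
      (∀ i, ∀ v ∈ R i, v ≠ d i → ∀ q ∈ Q, (∀ j, q ≠ s j) → G.Adj q v) ∧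
      ∀ i, ∀ v ∈ R i, v ≠ u i → ∀ q ∈ P, (∀ j, q ≠ t j) → G.Adj v q := by
  have hPY : P ⊆ Wᶜ ∪ P ∪ Q := fun z hz => by simp [hz]
  have hQY : Q ⊆ Wᶜ ∪ P ∪ Q := fun z hz => by simp [hz]
  obtain ⟨L, hL⟩ : ∃ L, G.IsMinimalLinkage (Wᶜ ∪ P ∪ Q) P Q L :=
    exists_minimal_linkage (exists_linkage hPY hsep)
  choose t ht s hs hpath using hL.1.1
  have htL : ∀ i, ∀ v ∈ L i, v ∈ P → v = t i := fun i v hv hvP =>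
    hL.eq_of_mem (hs i) (hpath i) hv hvP
  have hsL : ∀ i, ∀ v ∈ L i, v ∈ Q → v = s i := fun i v hv hvP =>
    hL.rev.eq_of_mem (ht i) (hpath i).rev (by simpa using hv) hvP
  have htm : ∀ i, t i ∈ L i := fun i => List.mem_of_mem_head? (hpath i).2.2.2.1
  have hsm : ∀ i, s i ∈ L i := fun i => List.mem_of_mem_getLast? (hpath i).2.2.2.2
  choose u hu1 hu2 hu3 hu4 hu5 using fun i =>
    hL.exists_second hPY (ht i) (hs i) (hpath i) hPQ hno
  choose d hd1 hd2 hd3 hd4 hd5 using fun i =>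
    hL.rev.exists_second hQY (hs i) (ht i) (hpath i).rev hPQ.symm fun x hx y hy => hno y hy x hx
  simp only [List.mem_reverse] at hd1 hd5
  have hR : ∀ i v, v ∈ (L i).toFinset \ {t i, s i} ↔ v ∈ L i ∧ v ≠ t i ∧ v ≠ s i := by
    intro i v
    simp
  have hRW : ∀ i, ∀ v ∈ (L i).toFinset \ {t i, s i}, v ∉ W := by
    intro i v hv hvW
    rw [hR] at hv
    have := (hpath i).2.2.1 v hv.1
    simp only [Finset.coe_union, Finset.coe_compl, Set.mem_union, Set.mem_compl_iff,
      Finset.mem_coe] at this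
    rcases this with (h | h) | h
    · exact h hvW
    · exact hv.2.1 (htL i v hv.1 h)
    · exact hv.2.2 (hsL i v hv.1 h)
  refine ⟨t, u, d, s, fun i => (L i).toFinset \ {t i, s i}, ht, hs, fun i j hij => ⟨?_, ?_, ?_⟩,
    fun i => Finset.disjoint_left.2 (hRW i), fun i => (hR i _).2 ⟨hu1 i, hu3 i, hu4 i⟩,
    fun i => (hR i _).2 ⟨hd1 i, hd4 i, hd3 i⟩, hu2, hd2, fun i => ?_, fun i v hv hvd q hq hqs => ?_,
    fun i v hv hvu q hq hqt => ?_⟩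
  · exact fun h => hL.1.2 i j hij (htm i) (h ▸ htm j)
  · exact fun h => hL.1.2 i j hij (hsm i) (h ▸ hsm j)
  · refine Finset.disjoint_left.2 fun z hz hz' => ?_
    exact hL.1.2 i j hij ((hR i z).1 hz).1 ((hR j z).1 hz').1
  · obtain ⟨h1, h2, -, h4⟩ := hpath i
    refine ⟨L i, h1, h2, fun z hz => ?_, h4⟩
    simp only [Finset.coe_union, Set.mem_union, Finset.mem_coe, hR]
    simp only [Finset.mem_insert, Finset.mem_singleton]
    tauto
  · have hne : q ≠ v := fun h => hRW i v hv (h ▸ hQ hq)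
    have hv' := (hR i v).1 hv
    exact hG.adj_of_not hne (hd5 i v hv'.1 hv'.2.2 hvd q hq fun j hj => hqs j (hsL j q hj hq))
  · have hne : v ≠ q := fun h => hRW i v hv (h ▸ hP hq)
    have hv' := (hR i v).1 hv
    exact hG.adj_of_not hne (hu5 i v hv'.1 hv'.2.1 hvu q hq fun j hj => hqt j (htL j q hj hq))

end Digr

namespace Digr

open scoped Classical

variable {V : Type}

/-- Among `10k` disjoint sets `R i` with two large sets `N i`, `N' i` attached, some `2k` can be
enlarged by `k` elements of `N i` and `k` elements of `N' i` and remain disjoint. -/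
theorem exists_disjoint_enlargement {k : ℕ} (R N N' : Fin (10 * k) → Finset V)
    (hR : ∀ i j, i ≠ j → Disjoint (R i) (R j))
    (hN : ∀ i, 40 * k ^ 3 + 4 * k ^ 2 ≤ (N i).card)
    (hN' : ∀ i, 40 * k ^ 3 + 4 * k ^ 2 ≤ (N' i).card) :
    ∃ (J : Finset (Fin (10 * k))) (φ ψ : Fin (10 * k) → Finset V), J.card = 2 * k ∧
      (∀ i ∈ J, φ i ⊆ N i ∧ (φ i).card = k) ∧ (∀ i ∈ J, ψ i ⊆ N' i ∧ (ψ i).card = k) ∧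
      ∀ i ∈ J, ∀ j ∈ J, i ≠ j → Disjoint (R i ∪ (φ i ∪ ψ i)) (R j ∪ (φ j ∪ ψ j)) := by
  have hf : ∀ N : Fin (10 * k) → Finset V, (∀ i, 40 * k ^ 3 + 4 * k ^ 2 ≤ (N i).card) →
      ∃ f : Fin (10 * k) → Fin (10 * k), ∀ i, ∀ J : Finset (Fin (10 * k)),
        (∀ j ∈ J, f i ≠ j) → 4 * k ^ 2 ≤ (N i \ J.biUnion R).card := by
    intro N hN
    have hfi : ∀ i, ∃ f, ∀ J : Finset (Fin (10 * k)), (∀ j ∈ J, f ≠ j) →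
        4 * k ^ 2 ≤ (N i \ J.biUnion R).card := by
      intro i
      by_cases h : ∃ f, 4 * k ^ 2 ≤ (N i ∩ R f).card
      · obtain ⟨f, hf⟩ := h
        refine ⟨f, fun J hJ => hf.trans (Finset.card_le_card fun z hz => ?_)⟩
        simp only [Finset.mem_inter, Finset.mem_sdiff, Finset.mem_biUnion, not_exists,
          not_and] at hz ⊢
        exact ⟨hz.1, fun j hj hzj => Finset.disjoint_left.1 (hR f j (hJ j hj)) hz.2 hzj⟩
      · push Not at h
        refine ⟨i, fun J _ => ?_⟩
        have h1 : (N i ∩ J.biUnion R).card ≤ J.card * (4 * k ^ 2) := by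
          rw [Finset.inter_biUnion]
          exact Finset.card_biUnion_le_card_mul _ _ _ fun j _ => (h j).le
        have h2 : J.card ≤ 10 * k := by simpa using Finset.card_le_univ J
        have h3 := Nat.mul_le_mul_right (4 * k ^ 2) h2
        have h4 := Finset.card_sdiff_add_card_inter (N i) (J.biUnion R)
        have h5 := hN i
        have h6 : 10 * k * (4 * k ^ 2) = 40 * k ^ 3 := by ring
        omega
    choose f hf using hfi
    exact ⟨f, hf⟩
  obtain ⟨f, hf'⟩ := hf N hN
  obtain ⟨g, hg'⟩ := hf N' hN'
  obtain ⟨J, -, hJc, hJ⟩ := exists_independent_subset f g (2 * k)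
    (Finset.univ : Finset (Fin (10 * k))) (by rw [Finset.card_univ, Fintype.card_fin]; omega)
  obtain ⟨φ, hφ, hφd⟩ := exists_disjoint_selection (J ×ˢ (Finset.univ : Finset Bool))
    (fun q => (bif q.2 then N q.1 else N' q.1) \ (J.erase q.1).biUnion R) k (4 * k ^ 2)
    (by rw [Finset.card_product, hJc]; simp; nlinarith) (by
      rintro ⟨i, b⟩ hi
      have hi := (Finset.mem_product.1 hi).1
      cases b
      · refine hg' i _ fun j hj => ?_
        exact (hJ i hi j (Finset.mem_of_mem_erase hj) (Finset.ne_of_mem_erase hj).symm).2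
      · refine hf' i _ fun j hj => ?_
        exact (hJ i hi j (Finset.mem_of_mem_erase hj) (Finset.ne_of_mem_erase hj).symm).1)
  have hm : ∀ i ∈ J, ∀ b, (i, b) ∈ J ×ˢ (Finset.univ : Finset Bool) := fun i hi b => by simp [hi]
  have hφR : ∀ i ∈ J, ∀ j ∈ J, i ≠ j → ∀ b, Disjoint (φ (i, b)) (R j) := by
    intro i hi j hj hij b
    refine Finset.disjoint_left.2 fun z hz hzj => ?_
    refine (Finset.mem_sdiff.1 ((hφ _ (hm i hi b)).1 hz)).2 (Finset.mem_biUnion.2 ⟨j, ?_, hzj⟩)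
    exact Finset.mem_erase.2 ⟨hij.symm, hj⟩
  have hφφ : ∀ i ∈ J, ∀ j ∈ J, i ≠ j → ∀ b b', Disjoint (φ (i, b)) (φ (j, b')) :=
    fun i hi j hj hij b b' => hφd _ (hm i hi b) _ (hm j hj b') fun h => hij (Prod.ext_iff.1 h).1
  refine ⟨J, fun i => φ (i, true), fun i => φ (i, false), hJc,
    fun i hi => ⟨(hφ _ (hm i hi true)).1.trans Finset.sdiff_subset, (hφ _ (hm i hi true)).2⟩,
    fun i hi => ⟨(hφ _ (hm i hi false)).1.trans Finset.sdiff_subset, (hφ _ (hm i hi false)).2⟩,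
    fun i hi j hj hij => ?_⟩
  simp only [Finset.disjoint_union_left, Finset.disjoint_union_right]
  exact ⟨⟨hR i j hij, hφR i hi j hj hij true, hφR i hi j hj hij false⟩,
    ⟨(hφR j hj i hi hij.symm true).symm, hφφ i hi j hj hij _ _, hφφ i hi j hj hij _ _⟩,
    ⟨(hφR j hj i hi hij.symm false).symm, hφφ i hi j hj hij _ _, hφφ i hi j hj hij _ _⟩⟩

/-- A set of good vertices remains good after adding path interiors `R i` together with private
neighbours of their exceptional vertices. -/
theorem inGood_union_interiors {G : Digr V} {EA EB Y : Finset V} {k : ℕ}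
    (hY : ∀ x ∈ Y, G.InGood EA Y k x ∧ G.rev.InGood EB Y k x) {ι : Type} {I : Finset ι}
    {R φ ψ : ι → Finset V} {u d : ι → V}
    (hφ : ∀ i ∈ I, (φ i).card = k ∧ ∀ w ∈ φ i, G.Adj w (d i) ∧ w ∉ EA ∧ w ∉ EB)
    (hψ : ∀ i ∈ I, (ψ i).card = k ∧ ∀ w ∈ ψ i, G.Adj (u i) w ∧ w ∉ EA ∧ w ∉ EB)
    {P Q : Finset V} (hQY : Q ⊆ Y) (hPY : P ⊆ Y) (hQ : k ≤ Q.card) (hP : k ≤ P.card)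
    (hRQ : ∀ i ∈ I, ∀ v ∈ R i, v ≠ d i → ∀ q ∈ Q, G.Adj q v)
    (hRP : ∀ i ∈ I, ∀ v ∈ R i, v ≠ u i → ∀ q ∈ P, G.Adj v q) :
    ∀ x ∈ Y ∪ I.biUnion (fun i => R i ∪ (φ i ∪ ψ i)),
      G.InGood EA (Y ∪ I.biUnion (fun i => R i ∪ (φ i ∪ ψ i))) k x ∧
        G.rev.InGood EB (Y ∪ I.biUnion (fun i => R i ∪ (φ i ∪ ψ i))) k x := by
  obtain ⟨Z, hZ⟩ : ∃ Z, Z = Y ∪ I.biUnion (fun i => R i ∪ (φ i ∪ ψ i)) := ⟨_, rfl⟩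
  rw [← hZ]
  have hYZ : Y ⊆ Z := by rw [hZ]; exact Finset.subset_union_left
  have hiZ : ∀ i ∈ I, R i ∪ (φ i ∪ ψ i) ⊆ Z := fun i hi => by
    rw [hZ]
    exact (Finset.subset_biUnion_of_mem (fun i => R i ∪ (φ i ∪ ψ i)) hi).trans
      Finset.subset_union_right
  have hYg : ∀ x ∈ Y, G.InGood EA Z k x ∧ G.rev.InGood EB Z k x := fun x hx =>
    ⟨(hY x hx).1.mono subset_rfl hYZ, (hY x hx).2.mono subset_rfl hYZ⟩
  have hbase : ∀ x ∈ Z, x ∉ EA ∧ x ∉ EB → G.InGood EA Z k x ∧ G.rev.InGood EB Z k x :=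
    fun x hx h => ⟨.base x hx h.1, .base x hx h.2⟩
  intro x hx
  have hx' := hx
  rw [hZ, Finset.mem_union, Finset.mem_biUnion] at hx'
  rcases hx' with hx' | ⟨i, hi, hx'⟩
  · exact hYg x hx'
  have hφg : ∀ w ∈ φ i, G.InGood EA Z k w ∧ G.rev.InGood EB Z k w := fun w hw =>
    hbase w (hiZ i hi (by simp [hw])) ((hφ i hi).2 w hw).2
  have hψg : ∀ w ∈ ψ i, G.InGood EA Z k w ∧ G.rev.InGood EB Z k w := fun w hw =>
    hbase w (hiZ i hi (by simp [hw])) ((hψ i hi).2 w hw).2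
  rcases Finset.mem_union.1 hx' with hxR | hx'
  · refine ⟨?_, ?_⟩
    · by_cases hxd : x = d i
      · exact .step x hx (φ i) (hφ i hi).1.ge (fun w hw => hxd ▸ ((hφ i hi).2 w hw).1)
          fun w hw => (hφg w hw).1
      · exact .step x hx Q hQ (hRQ i hi x hxR hxd) fun w hw => (hYg w (hQY hw)).1
    · by_cases hxu : x = u i
      · exact .step x hx (ψ i) (hψ i hi).1.ge (fun w hw => hxu ▸ ((hψ i hi).2 w hw).1)
          fun w hw => (hψg w hw).2
      · exact .step x hx P hP (hRP i hi x hxR hxu) fun w hw => (hYg w (hPY hw)).2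
  · rcases Finset.mem_union.1 hx' with hx' | hx'
    · exact hφg x hx'
    · exact hψg x hx'

end Digr

namespace Digr

open scoped Classical

variable {V : Type}

theorem exists_disjoint_subsets_card_eq {α : Type} {X : Finset α} {k : ℕ} (h : 2 * k ≤ X.card) :
    ∃ Y₁ Y₂, Y₁ ⊆ X ∧ Y₂ ⊆ X ∧ Y₁.card = k ∧ Y₂.card = k ∧ Disjoint Y₁ Y₂ := by
  obtain ⟨Y₁, h1, h2⟩ := Finset.exists_subset_card_eq (show k ≤ X.card by omega)
  obtain ⟨Y₂, h3, h4⟩ := Finset.exists_subset_card_eq (s := X \ Y₁) (n := k) (by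
    rw [Finset.card_sdiff_of_subset h1]; omega)
  exact ⟨Y₁, Y₂, h1, h3.trans Finset.sdiff_subset, h2, h4,
    Finset.disjoint_right.2 fun z hz => (Finset.mem_sdiff.1 (h3 hz)).2⟩

namespace Frame

variable [Fintype V] {G : Digr V} {k M : ℕ} {v₁ v₂ : V}

/-- The vertices covered by the sets of the frame indexed by `S'` and `T'`, together with `v`. -/
noncomputable def core (F : Frame G k M v₁ v₂) (v : V) (S' T' : Finset V) : Finset V :=
  insert v (S'.biUnion F.A ∪ T'.biUnion F.B)

theorem mem_core_iff {F : Frame G k M v₁ v₂} {v x : V} {S' T' : Finset V} :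
    x ∈ F.core v S' T' ↔ x = v ∨ (∃ s ∈ S', x ∈ F.A s) ∨ ∃ t ∈ T', x ∈ F.B t := by
  simp [core]

theorem disjoint_core (F : Frame G k M v₁ v₂) (hv : v₁ ≠ v₂) {S₁ S₂ T₁ T₂ : Finset V}
    (hS₁ : S₁ ⊆ F.S) (hS₂ : S₂ ⊆ F.S) (hT₁ : T₁ ⊆ F.T) (hT₂ : T₂ ⊆ F.T)
    (hS : Disjoint S₁ S₂) (hT : Disjoint T₁ T₂) :
    Disjoint (F.core v₁ S₁ T₁) (F.core v₂ S₂ T₂) := by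
  refine Finset.disjoint_left.2 fun x hx hx' => ?_
  rw [mem_core_iff] at hx hx'
  rcases hx with rfl | ⟨s, hs, hx⟩ | ⟨t, ht, hx⟩ <;>
    rcases hx' with h | ⟨s', hs', hx'⟩ | ⟨t', ht', hx'⟩
  · exact hv h
  · exact (F.notMem_A s' (hS₂ hs')).1 hx'
  · exact (F.notMem_B t' (hT₂ ht')).1 hx'
  · subst h; exact (F.notMem_A s (hS₁ hs)).2 hx
  · refine Finset.disjoint_left.1 (F.disjoint_A s (hS₁ hs) s' (hS₂ hs') ?_) hx hx'
    rintro rfl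
    exact Finset.disjoint_left.1 hS hs hs'
  · exact Finset.disjoint_left.1 (F.disjoint_AB s (hS₁ hs) t' (hT₂ ht')) hx hx'
  · subst h; exact (F.notMem_B t (hT₁ ht)).2 hx
  · exact Finset.disjoint_left.1 (F.disjoint_AB s' (hS₂ hs') t (hT₁ ht)) hx' hx
  · refine Finset.disjoint_left.1 (F.disjoint_B t (hT₁ ht) t' (hT₂ ht') ?_) hx hx'
    rintro rfl
    exact Finset.disjoint_left.1 hT ht ht'

theorem core_subset_X (F : Frame G k M v₁ v₂) {v : V} (hv : v ∈ F.X) {S' T' : Finset V}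
    (hS' : S' ⊆ F.S) (hT' : T' ⊆ F.T) : F.core v S' T' ⊆ F.X := by
  intro x hx
  rcases mem_core_iff.1 hx with rfl | ⟨s, hs, hx⟩ | ⟨t, ht, hx⟩
  · exact hv
  · exact F.A_subset_X (hS' hs) hx
  · exact F.B_subset_X (hT' ht) hx

theorem S_subset_X (F : Frame G k M v₁ v₂) : F.S ⊆ F.X := fun s hs =>
  F.A_subset_X hs (F.isSource s hs).1

theorem T_subset_X (F : Frame G k M v₁ v₂) : F.T ⊆ F.X := fun t ht =>
  F.B_subset_X ht (F.isSink t ht).1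

/-- The partition theorem when no vertex of `T'` has a short connection to `S'` outside `W`. -/
theorem exists_partition_of_no_short (F : Frame G k M v₁ v₂) (hG : G.IsTournament) (hk : 1 ≤ k)
    (hv : v₁ ≠ v₂) {K : ℕ} (hconn : G.HighlyConn K) {S' T' W : Finset V} {r : V → V}
    (hS' : S' ⊆ F.S) (hT' : T' ⊆ F.T) (hSc : 12 * k ≤ S'.card) (hTc : 12 * k ≤ T'.card)
    (hXW : F.X ⊆ W) (hr : ∀ x ∈ F.X, r x = x) (hWK : W.card + 10 * k ≤ K)
    (hWM : W.card + (40 * k ^ 3 + 4 * k ^ 2) ≤ M)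
    (hshort : ∀ t ∈ T', ∀ s ∈ S', ∀ Z : Finset V, Z.card ≤ 2 → Disjoint Z W →
      ¬ G.Reaches ↑({t, s} ∪ Z) t s)
    (hgood : ∀ x ∈ W, G.InGood (F.EA F.S) (W.filter fun y => r y = r x) k x ∧
      G.rev.InGood (F.EB F.T) (W.filter fun y => r y = r x) k x) :
    ∃ U : Finset V, v₁ ∈ U ∧ v₂ ∉ U ∧ G.StronglyConnOn U k ∧ G.StronglyConnOn ↑(Uᶜ) k := by
  have hSX := hS'.trans F.S_subset_X
  have hTX := hT'.trans F.T_subset_X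
  have hLX : F.L ⊆ F.X := F.L_subset
  have hno₀ : ∀ t ∈ T', ∀ s ∈ S', ¬ G.Adj t s := fun t ht s hs h =>
    hshort t ht s hs ∅ (by simp) (by simp) (.of_adj (by simp) (by simp) h)
  have hno₁ : ∀ t ∈ T', ∀ s ∈ S', ∀ x, x ∉ W → G.Adj t x → ¬ G.Adj x s := by
    intro t ht s hs x hx h1 h2
    exact hshort t ht s hs {x} (by simp) (by simpa using hx)
      ((Reaches.of_adj (by simp) (by simp) h1).trans (.of_adj (by simp) (by simp) h2))
  have hno₂ : ∀ t ∈ T', ∀ s ∈ S', ∀ x, x ∉ W → ∀ y, y ∉ W → G.Adj t x → G.Adj x y →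
      ¬ G.Adj y s := by
    intro t ht s hs x hx y hy h1 h2 h3
    exact hshort t ht s hs {x, y} Finset.card_le_two (by simp [hx, hy])
      (((Reaches.of_adj (by simp) (by simp) h1).trans (.of_adj (by simp) (by simp) h2)).trans
        (.of_adj (by simp) (by simp) h3))
  have hEA : ∀ v ∈ F.EA S', ∃ s ∈ S', G.Adj v s := by
    intro v hv
    obtain ⟨s, hs, h⟩ := Finset.mem_biUnion.1 hv
    exact ⟨s, hs, mem_undom.1 h s (F.isSource s (hS' hs)).1⟩
  have hEB : ∀ v ∈ F.EB T', ∃ t ∈ T', G.Adj t v := by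
    intro v hv
    obtain ⟨t, ht, h⟩ := Finset.mem_biUnion.1 hv
    exact ⟨t, ht, mem_undom.1 h t (F.isSink t (hT' ht)).1⟩
  have hEAS : F.EA S' ⊆ F.EA F.S := Finset.biUnion_subset_biUnion_of_subset_left _ hS'
  have hEBT : F.EB T' ⊆ F.EB F.T := Finset.biUnion_subset_biUnion_of_subset_left _ hT'
  have hin : ∀ v, v ∉ W → M ≤ (G.inNbr v \ F.EA S').card := fun v hv =>
    (F.le_in v fun h => hv (hXW (hLX h))).trans
      (Finset.card_le_card (Finset.sdiff_subset_sdiff subset_rfl hEAS))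
  have hout : ∀ v, v ∉ W → M ≤ (G.rev.inNbr v \ F.EB T').card := fun v hv =>
    (F.le_out v fun h => hv (hXW (hLX h))).trans
      (Finset.card_le_card (Finset.sdiff_subset_sdiff subset_rfl hEBT))
  have hTS : Disjoint T' S' := Finset.disjoint_left.2 fun z hz hz' =>
    F.ne_of_mem (hS' hz') (hT' hz) rfl
  obtain ⟨t, u, d, s, R, ht, hs, hdis, hRW, hu, hd, htu, hds, hreach, hRS, hRT⟩ :=
    hG.exists_directed_linkage (p := 10 * k) (hTX.trans hXW) (hSX.trans hXW) hTS hno₀ (by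
      intro Z hZ
      obtain ⟨x, hx⟩ : (T' \ Z).Nonempty := by
        rw [← Finset.card_pos]
        have := Finset.le_card_sdiff Z T'
        omega
      obtain ⟨y, hy⟩ : (S' \ Z).Nonempty := by
        rw [← Finset.card_pos]
        have := Finset.le_card_sdiff Z S'
        omega
      refine ⟨x, hx, y, hy, (hconn.2 (Z ∪ (W \ (T' ∪ S'))) ?_ x ?_ y ?_).mono ?_⟩
      · have := Finset.card_union_le Z (W \ (T' ∪ S'))
        have := Finset.card_le_card (Finset.sdiff_subset (s := W) (t := T' ∪ S'))
        omega
      · rw [Finset.mem_sdiff] at hx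
        simp [hx.1, hx.2]
      · rw [Finset.mem_sdiff] at hy
        simp [hy.1, hy.2]
      · intro z
        simp only [Set.mem_compl_iff, Finset.mem_coe, Finset.mem_union, Finset.mem_sdiff,
          Set.mem_sdiff, Finset.mem_compl]
        tauto)
  have hspare : ∀ (X : Finset V) (f : Fin (10 * k) → V), 12 * k ≤ X.card →
      2 * k ≤ (X \ Finset.univ.image f).card := by
    intro X f hX
    have h1 := Finset.le_card_sdiff (Finset.univ.image f) X
    have h2 := (Finset.card_image_le (s := Finset.univ) (f := f)).trans
      (by rw [Finset.card_univ, Fintype.card_fin] : _ ≤ 10 * k)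
    omega
  have hsp : ∀ {X : Finset V} {f : Fin (10 * k) → V} {q : V},
      q ∈ X \ Finset.univ.image f → q ∈ X ∧ ∀ j, q ≠ f j := by
    intro X f q hq
    simp only [Finset.mem_sdiff, Finset.mem_image, Finset.mem_univ, true_and, not_exists] at hq
    exact ⟨hq.1, fun j h => hq.2 j h.symm⟩
  obtain ⟨Q₁, Q₂, hQ₁, hQ₂, hQ₁k, hQ₂k, hQ⟩ := exists_disjoint_subsets_card_eq (hspare S' s hSc)
  obtain ⟨P₁, P₂, hP₁, hP₂, hP₁k, hP₂k, hP⟩ := exists_disjoint_subsets_card_eq (hspare T' t hTc)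
  have hRW' : ∀ i, ∀ v ∈ R i, v ∉ W := fun i v => (Finset.disjoint_left.1 (hRW i) ·)
  obtain ⟨J, φ, ψ, hJ, hφ, hψ, hD⟩ := exists_disjoint_enlargement R
    (fun i => (G.inNbr (d i) \ F.EA S') \ W) (fun i => (G.rev.inNbr (u i) \ F.EB T') \ W)
    (fun i j hij => (hdis i j hij).2.2) (fun i => by
      have h1 := hin _ (hRW' i _ (hd i))
      have h2 := Finset.le_card_sdiff W (G.inNbr (d i) \ F.EA S')
      omega) (fun i => by
      have h1 := hout _ (hRW' i _ (hu i))
      have h2 := Finset.le_card_sdiff W (G.rev.inNbr (u i) \ F.EB T')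
      omega)
  have hφ' : ∀ i ∈ J, (φ i).card = k ∧
      ∀ w ∈ φ i, G.Adj w (d i) ∧ w ∉ F.EA S' ∧ w ∉ F.EB T' := by
    intro i hi
    refine ⟨(hφ i hi).2, fun w hw => ?_⟩
    have h := (hφ i hi).1 hw
    simp only [Finset.mem_sdiff, mem_inNbr] at h
    refine ⟨h.1.1, h.1.2, fun hB => ?_⟩
    obtain ⟨t', ht', h'⟩ := hEB w hB
    exact hno₂ t' ht' _ (hs i) w h.2 _ (hRW' i _ (hd i)) h' h.1.1 (hds i)
  have hψ' : ∀ i ∈ J, (ψ i).card = k ∧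
      ∀ w ∈ ψ i, G.Adj (u i) w ∧ w ∉ F.EA S' ∧ w ∉ F.EB T' := by
    intro i hi
    refine ⟨(hψ i hi).2, fun w hw => ?_⟩
    have h := (hψ i hi).1 hw
    simp only [Finset.mem_sdiff, mem_inNbr] at h
    refine ⟨h.1.1, fun hA => ?_, h.1.2⟩
    obtain ⟨s', hs', h'⟩ := hEA w hA
    exact hno₂ _ (ht i) s' hs' _ (hRW' i _ (hu i)) w h.2 (htu i) h.1.1 h'
  have hDW : ∀ i ∈ J, Disjoint W (R i ∪ (φ i ∪ ψ i)) := by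
    intro i hi
    refine Finset.disjoint_right.2 fun w hw => ?_
    rcases Finset.mem_union.1 hw with hw | hw
    · exact hRW' i w hw
    · rcases Finset.mem_union.1 hw with hw | hw
      · exact (Finset.mem_sdiff.1 ((hφ i hi).1 hw)).2
      · exact (Finset.mem_sdiff.1 ((hψ i hi).1 hw)).2
  have hside : ∀ I ⊆ J, ∀ Q ⊆ S' \ Finset.univ.image s, ∀ P ⊆ T' \ Finset.univ.image t,
      Q.card = k → P.card = k → ∀ Y ⊆ W, (∀ x ∈ Y, (W.filter fun y => r y = r x) ⊆ Y) → Q ⊆ Y →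
      P ⊆ Y → ∀ x ∈ Y ∪ I.biUnion (fun i => R i ∪ (φ i ∪ ψ i)),
        G.InGood (F.EA S') (Y ∪ I.biUnion (fun i => R i ∪ (φ i ∪ ψ i))) k x ∧
          G.rev.InGood (F.EB T') (Y ∪ I.biUnion (fun i => R i ∪ (φ i ∪ ψ i))) k x := by
    intro I hI Q hQ P hP hQk hPk Y hYW hY hQY hPY
    refine inGood_union_interiors (fun x hx => ?_) (fun i hi => hφ' i (hI hi))
      (fun i hi => hψ' i (hI hi)) hQY hPY hQk.ge hPk.ge
      (fun i _ v hv hvd q hq => hRS i v hv hvd q (hsp (hQ hq)).1 (hsp (hQ hq)).2)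
      fun i _ v hv hvu q hq => hRT i v hv hvu q (hsp (hP hq)).1 (hsp (hP hq)).2
    have := hgood x (hYW hx)
    exact ⟨this.1.mono hEAS (hY x hx), this.2.mono hEBT (hY x hx)⟩
  have hfinal : ∀ I ⊆ J, I.card = k → ∀ U : Finset V,
      I.biUnion (fun i => R i ∪ (φ i ∪ ψ i)) ⊆ U → (I.image s).biUnion F.A ⊆ U →
      (I.image t).biUnion F.B ⊆ U →
      (∀ x ∈ U, G.InGood (F.EA S') U k x ∧ G.rev.InGood (F.EB T') U k x) →
      G.StronglyConnOn U k := by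
    intro I _ hIk U h1 h2 h3 h4
    refine F.stronglyConnOn hG hk hS' hT' hIk.ge t s R (fun i _ => ht i) (fun i _ => hs i)
      (fun i _ j _ => hdis i j) (fun i _ => (hRW i).mono_right hXW) (fun i hi => ?_)
      (fun i _ => hreach i) h4
    refine Finset.union_subset (Finset.union_subset ?_ ?_) ?_
    · exact (Finset.subset_biUnion_of_mem F.B (Finset.mem_image_of_mem t hi)).trans h3
    · refine Finset.Subset.trans ?_ h1
      exact Finset.subset_union_left.trans
        (Finset.subset_biUnion_of_mem (fun i => R i ∪ (φ i ∪ ψ i)) hi)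
    · exact (Finset.subset_biUnion_of_mem F.A (Finset.mem_image_of_mem s hi)).trans h2
  obtain ⟨I₁, I₂, hI₁, hI₂, hI₁k, hI₂k, hI⟩ := exists_disjoint_subsets_card_eq hJ.ge
  have hSsub : ∀ I : Finset (Fin (10 * k)), ∀ Q ⊆ S' \ Finset.univ.image s,
      I.image s ∪ Q ⊆ F.S := fun I Q hQ => by
    refine Finset.union_subset (fun z hz => ?_) fun q hq => hS' (hsp (hQ hq)).1
    obtain ⟨i, -, rfl⟩ := Finset.mem_image.1 hz
    exact hS' (hs i)
  have hTsub : ∀ I : Finset (Fin (10 * k)), ∀ P ⊆ T' \ Finset.univ.image t,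
      I.image t ∪ P ⊆ F.T := fun I P hP => by
    refine Finset.union_subset (fun z hz => ?_) fun q hq => hT' (hsp (hP hq)).1
    obtain ⟨i, -, rfl⟩ := Finset.mem_image.1 hz
    exact hT' (ht i)
  have hdisj : ∀ {f : Fin (10 * k) → V}, (∀ i j, i ≠ j → f i ≠ f j) →
      ∀ {X Z₁ Z₂ : Finset V}, Z₁ ⊆ X \ Finset.univ.image f → Z₂ ⊆ X \ Finset.univ.image f →
      Disjoint Z₁ Z₂ → Disjoint (I₁.image f ∪ Z₁) (I₂.image f ∪ Z₂) := by
    intro f hf X Z₁ Z₂ h1 h2 h12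
    simp only [Finset.disjoint_union_left, Finset.disjoint_union_right]
    refine ⟨⟨Finset.disjoint_left.2 fun z hz hz' => ?_, Finset.disjoint_left.2 fun z hz hz' => ?_⟩,
      Finset.disjoint_left.2 fun z hz hz' => ?_, h12⟩
    · obtain ⟨i, hi, rfl⟩ := Finset.mem_image.1 hz
      obtain ⟨j, hj, hij⟩ := Finset.mem_image.1 hz'
      refine hf j i ?_ hij
      rintro rfl
      exact Finset.disjoint_left.1 hI hi hj
    · obtain ⟨j, -, rfl⟩ := Finset.mem_image.1 hz'
      exact (hsp (h1 hz)).2 j rfl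
    · obtain ⟨j, -, rfl⟩ := Finset.mem_image.1 hz
      exact (hsp (h2 hz')).2 j rfl
  obtain ⟨C₁, hC₁⟩ : ∃ C, C = F.core v₁ (I₁.image s ∪ Q₁) (I₁.image t ∪ P₁) := ⟨_, rfl⟩
  obtain ⟨C₂, hC₂⟩ : ∃ C, C = F.core v₂ (I₂.image s ∪ Q₂) (I₂.image t ∪ P₂) := ⟨_, rfl⟩
  have hCC : Disjoint C₁ C₂ := by
    rw [hC₁, hC₂]
    exact F.disjoint_core hv (hSsub _ _ hQ₁) (hSsub _ _ hQ₂) (hTsub _ _ hP₁) (hTsub _ _ hP₂)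
      (hdisj (fun i j hij => (hdis i j hij).2.1) hQ₁ hQ₂ hQ)
      (hdisj (fun i j hij => (hdis i j hij).1) hP₁ hP₂ hP)
  have hC₁X : C₁ ⊆ F.X := by
    rw [hC₁]
    exact F.core_subset_X F.left_mem_X (hSsub _ _ hQ₁) (hTsub _ _ hP₁)
  have hC₂X : C₂ ⊆ F.X := by
    rw [hC₂]
    exact F.core_subset_X F.right_mem_X (hSsub _ _ hQ₂) (hTsub _ _ hP₂)
  have hcore : ∀ {v : V} {I : Finset (Fin (10 * k))} {Q P : Finset V},
      Q ⊆ S' \ Finset.univ.image s → P ⊆ T' \ Finset.univ.image t →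
      (I.image s).biUnion F.A ⊆ F.core v (I.image s ∪ Q) (I.image t ∪ P) ∧
      (I.image t).biUnion F.B ⊆ F.core v (I.image s ∪ Q) (I.image t ∪ P) ∧
      Q ⊆ F.core v (I.image s ∪ Q) (I.image t ∪ P) ∧
      P ⊆ F.core v (I.image s ∪ Q) (I.image t ∪ P) := by
    intro v I Q P hQ hP
    refine ⟨fun z hz => ?_, fun z hz => ?_, fun z hz => ?_, fun z hz => ?_⟩ <;> rw [mem_core_iff]
    · obtain ⟨x, hx, hzx⟩ := Finset.mem_biUnion.1 hz
      exact .inr (.inl ⟨x, Finset.mem_union_left _ hx, hzx⟩)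
    · obtain ⟨x, hx, hzx⟩ := Finset.mem_biUnion.1 hz
      exact .inr (.inr ⟨x, Finset.mem_union_left _ hx, hzx⟩)
    · exact .inr (.inl ⟨z, Finset.mem_union_right _ hz,
        (F.isSource z (hS' (hsp (hQ hz)).1)).1⟩)
    · exact .inr (.inr ⟨z, Finset.mem_union_right _ hz, (F.isSink z (hT' (hsp (hP hz)).1)).1⟩)
  obtain ⟨hA₁, hB₁, hQC₁, hPC₁⟩ := hcore (v := v₁) (I := I₁) hQ₁ hP₁
  obtain ⟨hA₂, hB₂, hQC₂, hPC₂⟩ := hcore (v := v₂) (I := I₂) hQ₂ hP₂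
  rw [← hC₁] at hA₁ hB₁ hQC₁ hPC₁
  rw [← hC₂] at hA₂ hB₂ hQC₂ hPC₂
  obtain ⟨W₁, hW₁⟩ : ∃ Y, Y = W.filter fun x => r x ∈ C₁ := ⟨_, rfl⟩
  obtain ⟨W₂, hW₂⟩ : ∃ Y, Y = W.filter fun x => r x ∉ C₁ := ⟨_, rfl⟩
  have hW₁W : W₁ ⊆ W := hW₁ ▸ Finset.filter_subset _ _
  have hW₂W : W₂ ⊆ W := hW₂ ▸ Finset.filter_subset _ _
  have hCW₁ : C₁ ⊆ W₁ := fun x hx => by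
    rw [hW₁, Finset.mem_filter, hr x (hC₁X hx)]
    exact ⟨hXW (hC₁X hx), hx⟩
  have hCW₂ : C₂ ⊆ W₂ := fun x hx => by
    rw [hW₂, Finset.mem_filter, hr x (hC₂X hx)]
    exact ⟨hXW (hC₂X hx), Finset.disjoint_right.1 hCC hx⟩
  have hfib₁ : ∀ x ∈ W₁, (W.filter fun y => r y = r x) ⊆ W₁ := by
    intro x hx y hy
    rw [hW₁, Finset.mem_filter] at hx ⊢
    rw [Finset.mem_filter] at hy
    exact ⟨hy.1, hy.2 ▸ hx.2⟩
  have hfib₂ : ∀ x ∈ W₂, (W.filter fun y => r y = r x) ⊆ W₂ := by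
    intro x hx y hy
    rw [hW₂, Finset.mem_filter] at hx ⊢
    rw [Finset.mem_filter] at hy
    exact ⟨hy.1, hy.2 ▸ hx.2⟩
  have hg₁ := hside I₁ hI₁ Q₁ hQ₁ P₁ hP₁ hQ₁k hP₁k W₁ hW₁W hfib₁ (hQC₁.trans hCW₁)
    (hPC₁.trans hCW₁)
  have hg₂ := hside I₂ hI₂ Q₂ hQ₂ P₂ hP₂ hQ₂k hP₂k W₂ hW₂W hfib₂ (hQC₂.trans hCW₂)
    (hPC₂.trans hCW₂)
  obtain ⟨Y₁, hY₁⟩ : ∃ Y, Y = W₁ ∪ I₁.biUnion (fun i => R i ∪ (φ i ∪ ψ i)) := ⟨_, rfl⟩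
  obtain ⟨Y₂, hY₂⟩ : ∃ Y, Y = W₂ ∪ I₂.biUnion (fun i => R i ∪ (φ i ∪ ψ i)) := ⟨_, rfl⟩
  rw [← hY₁] at hg₁
  rw [← hY₂] at hg₂
  have hWY₁ : W₁ ⊆ Y₁ := hY₁ ▸ Finset.subset_union_left
  have hWY₂ : W₂ ⊆ Y₂ := hY₂ ▸ Finset.subset_union_left
  have hIY₁ : I₁.biUnion (fun i => R i ∪ (φ i ∪ ψ i)) ⊆ Y₁ := hY₁ ▸ Finset.subset_union_right
  have hIY₂ : I₂.biUnion (fun i => R i ∪ (φ i ∪ ψ i)) ⊆ Y₂ := hY₂ ▸ Finset.subset_union_right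
  have hYdisj : Disjoint Y₁ Y₂ := by
    rw [hY₁, hY₂]
    rw [Finset.disjoint_union_left, Finset.disjoint_union_right, Finset.disjoint_union_right,
      Finset.disjoint_biUnion_left, Finset.disjoint_biUnion_left, Finset.disjoint_biUnion_right]
    refine ⟨⟨?_, fun j hj => (hDW j (hI₂ hj)).mono_left hW₁W⟩,
      fun i hi => ((hDW i (hI₁ hi)).mono_left hW₂W).symm, fun i hi => ?_⟩
    · rw [hW₁, hW₂]
      exact Finset.disjoint_filter_filter_not _ _ _
    · rw [Finset.disjoint_biUnion_right]
      exact fun j hj => hD _ (hI₁ hi) _ (hI₂ hj)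
        fun hij => Finset.disjoint_left.1 hI hi (hij ▸ hj)
  have hYW : ∀ v, v ∉ Y₁ → v ∉ Y₂ → v ∉ W := by
    intro v h1 h2 hvW
    by_cases h : r v ∈ C₁
    · exact h1 (hWY₁ (by rw [hW₁]; exact Finset.mem_filter.2 ⟨hvW, h⟩))
    · exact h2 (hWY₂ (by rw [hW₂]; exact Finset.mem_filter.2 ⟨hvW, h⟩))
  have h2k : 2 * k ≤ M := by
    have : k ≤ k ^ 2 := by nlinarith
    omega
  obtain ⟨V₁, V₂, hYV₁, hYV₂, hV, hV', hgV₁, hgV₂⟩ := exists_good_partition hYdisj hg₁ hg₂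
    (fun v h1 h2 hvA hvB => by
      obtain ⟨s', hs', h⟩ := hEA v hvA
      obtain ⟨t', ht', h'⟩ := hEB v hvB
      exact hno₁ t' ht' s' hs' v (hYW v h1 h2) h' h)
    (fun v h1 h2 _ => h2k.trans (hin v (hYW v h1 h2)))
    (fun v h1 h2 _ => h2k.trans (hout v (hYW v h1 h2)))
    (fun x y h1 h2 h3 h4 hxB hyA hxy => by
      obtain ⟨s', hs', h⟩ := hEA y hyA
      obtain ⟨t', ht', h'⟩ := hEB x hxB
      exact hno₂ t' ht' s' hs' x (hYW x h1 h2) y (hYW y h3 h4) h' hxy h)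
  have hVc : V₁ᶜ = V₂ := by
    refine compl_unique (disjoint_iff.1 hV) (by simpa using hV')
  have hCV₁ := (hCW₁.trans hWY₁).trans hYV₁
  have hCV₂ := (hCW₂.trans hWY₂).trans hYV₂
  refine ⟨V₁, hCV₁ ?_, ?_, ?_, ?_⟩
  · rw [hC₁, mem_core_iff]; exact .inl rfl
  · refine Finset.disjoint_right.1 hV (hCV₂ ?_)
    rw [hC₂, mem_core_iff]; exact .inl rfl
  · exact hfinal I₁ hI₁ hI₁k V₁ (hIY₁.trans hYV₁) (hA₁.trans hCV₁) (hB₁.trans hCV₁) hgV₁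
  · rw [hVc]
    exact hfinal I₂ hI₂ hI₂k V₂ (hIY₂.trans hYV₂) (hA₂.trans hCV₂) (hB₂.trans hCV₂) hgV₂

end Frame

end Digr

namespace Digr

variable {V : Type}

theorem StronglyConnOn.mono {G : Digr V} {W : Set V} {j k : ℕ} (h : G.StronglyConnOn W k)
    (hjk : j ≤ k) : G.StronglyConnOn W j :=
  ⟨(Nat.succ_le_succ hjk).trans h.1,
    fun u hu v hv huv S hS hSj => h.2 u hu v hv huv S hS (hSj.trans_le hjk)⟩

open scoped Classical in
theorem IsTournament.exists_partition [Fintype V] {G : Digr V} (hG : G.IsTournament) {k M : ℕ} (hk : 1 ≤ k)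
    (hM : 300 * (k ^ 2 * (k + 1) ^ 2) ≤ M) (hconn : G.HighlyConn (4 * M)) {v₁ v₂ : V}
    (hv : v₁ ≠ v₂) :
    ∃ U : Finset V, v₁ ∈ U ∧ v₂ ∉ U ∧ G.StronglyConnOn U k ∧ G.StronglyConnOn ↑(Uᶜ) k := by
  have hk4 : 4 * k ^ 2 ≤ k ^ 2 * (k + 1) ^ 2 := by
    have : 4 ≤ (k + 1) ^ 2 := Nat.pow_le_pow_left (show 2 ≤ k + 1 by omega) 2
    nlinarith
  have hk3 : 2 * k ^ 3 ≤ k ^ 2 * (k + 1) ^ 2 := by nlinarith [Nat.mul_le_mul_left (k ^ 2) (show 2 * k ≤ (k + 1) ^ 2 by nlinarith)]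
  have hk1 : k ≤ k ^ 2 := by nlinarith
  have hM' : 242 * k ^ 2 * (k + 1) ^ 2 ≤ M := by rw [mul_assoc]; omega
  obtain ⟨F⟩ := hG.exists_frame hk (show 184 * k ^ 2 ≤ M by omega) hconn v₁ v₂
  obtain ⟨H, hH, hHk, hmax⟩ := G.exists_isShortFamily F.T F.S F.X k
  have hX' : (F.X ∪ H.biUnion fun q => q.2.2).card ≤ 186 * k ^ 2 := by
    have h1 : (H.biUnion fun q => q.2.2).card ≤ H.card * 2 :=
      Finset.card_biUnion_le_card_mul _ _ _ fun q hq => (hH.1 q hq).2.2.1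
    have h2 := F.card_X_le hk
    have h3 := Finset.card_union_le F.X (H.biUnion fun q => q.2.2)
    omega
  obtain ⟨W, r, hXW, -, hr, hW, hgood⟩ := exists_closure (EA := F.EA F.S) (EB := F.EB F.T) hk
    (Finset.Subset.trans F.L_subset Finset.subset_union_left) F.card_L hX' hM'
    (fun v => (show M ≤ 4 * M by omega).trans (hconn.le_card_inNbr hG.1 v))
    (fun v => (show M ≤ 4 * M by omega).trans (hconn.rev.le_card_inNbr hG.1 v))
    F.le_in F.le_out F.le_both
  rw [mul_assoc] at hW
  by_cases hc : H.card = k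
  · exact F.exists_partition_of_short hG hk hv hconn hH hc hXW hr (by omega) hgood
  have hcard : ∀ (Y : Finset V) (f : V × V × Finset V → V), Y.card = 13 * k →
      12 * k ≤ (Y \ H.image f).card := fun Y f hY => by
    have h1 := Finset.le_card_sdiff (H.image f) Y
    have h2 : (H.image f).card ≤ H.card := Finset.card_image_le
    omega
  exact F.exists_partition_of_no_short hG hk hv hconn Finset.sdiff_subset Finset.sdiff_subset
    (hcard _ _ F.card_S) (hcard _ _ F.card_T) (Finset.subset_union_left.trans hXW)
    (fun x hx => hr x (Finset.mem_union_left _ hx)) (by omega) (by omega)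
    (fun t ht s hs Z hZ hZW => hmax.resolve_left hc t ht s hs Z hZ (hZW.mono_right hXW)) hgood

end Digr

/-- For `k₁, k₂ ≥ 1` and `k = max(k₁,k₂)`, every strongly `8·10⁸·k²·(k+1)²`-connected
tournament with distinct vertices `v₁, v₂` can be partitioned into `V₁ ∋ v₁` and
`V₂ ∋ v₂` such that `T[V₁]` is strongly `k₁`-connected and `T[V₂]` is strongly
`k₂`-connected. -/
theorem stmt12 {V : Type} [Fintype V] (k₁ k₂ : ℕ) (h₁ : 1 ≤ k₁) (h₂ : 1 ≤ k₂)
    (T : Digr V) (hT : T.IsTournament)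
    (hconn : T.StronglyConnOn Set.univ
      (8 * 10 ^ 8 * (max k₁ k₂) ^ 2 * (max k₁ k₂ + 1) ^ 2))
    (v₁ v₂ : V) (hv : v₁ ≠ v₂) :
    ∃ V₁ V₂ : Set V, Disjoint V₁ V₂ ∧ V₁ ∪ V₂ = Set.univ ∧
      v₁ ∈ V₁ ∧ v₂ ∈ V₂ ∧
      T.StronglyConnOn V₁ k₁ ∧ T.StronglyConnOn V₂ k₂ := by
  classical
  obtain ⟨U, h1, h2, h3, h4⟩ := hT.exists_partition (k := max k₁ k₂)
    (M := 2 * 10 ^ 8 * (max k₁ k₂) ^ 2 * (max k₁ k₂ + 1) ^ 2) (h₁.trans (le_max_left _ _))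
    (by rw [mul_assoc]; exact Nat.mul_le_mul_right _ (by norm_num))
    (by convert hconn.highlyConn using 1; ring) hv
  rw [Finset.coe_compl] at h4
  exact ⟨U, (↑U)ᶜ, disjoint_compl_right, Set.union_compl_self _, h1, h2,
    h3.mono (le_max_left _ _), h4.mono (le_max_right _ _)⟩
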